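/- arXiv:1610.07081 — 8 statements merged into one kernel-verified Lean document; each statement's English description precedes it below -/
import Mathlib

section
/- Let a, b, c, d be real numbers. Then the fixation probability ρ_A(N,w) of the frequency-dependent Moran process under weak selection satisfies ρ_A(N,w) = 1/N + (w/6)(a + 2b − c − 2d) + w·R(N,w), where the remainder R satisfies the iterated limit lim_{N→∞} lim_{w→0⁺} R(N,w) = 0; equivalently, lim_{N→∞} lim_{w→0⁺} (ρ_A(N,w) − 1/N − (w/6)(a + 2b − c − 2d))/w = 0. -/
open Filter Finset Topology

/-- Fitness of strategy A under weak selection. -/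
noncomputable def fA (a b : ℝ) (N : ℕ) (w : ℝ) (i : ℕ) : ℝ :=
  1 + w * (a * ((i : ℝ) - 1) + b * ((N : ℝ) - (i : ℝ))) / ((N : ℝ) - 1)

/-- Fitness of strategy B under weak selection. -/
noncomputable def fB (c d : ℝ) (N : ℕ) (w : ℝ) (i : ℕ) : ℝ :=
  1 + w * (c * (i : ℝ) + d * ((N : ℝ) - (i : ℝ) - 1)) / ((N : ℝ) - 1)

/-- Fixation probability of strategy A in the frequency-dependent Moran process. -/
noncomputable def rhoA (a b c d : ℝ) (N : ℕ) (w : ℝ) : ℝ :=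
  1 / (1 + ∑ k ∈ Icc 1 (N - 1), ∏ j ∈ Icc 1 k, fB c d N w j / fA a b N w j)

/-- Fixation probability of strategy B in the frequency-dependent Moran process. -/
noncomputable def rhoB (a b c d : ℝ) (N : ℕ) (w : ℝ) : ℝ :=
  1 / (1 + ∑ k ∈ Icc 1 (N - 1), ∏ j ∈ Icc 1 k, fA a b N w (N - j) / fB c d N w (N - j))

lemma fA_deriv (a b : ℝ) (N i : ℕ) :
    HasDerivAt (fun w : ℝ => fA a b N w i)
      ((a * ((i : ℝ) - 1) + b * ((N : ℝ) - (i : ℝ))) / ((N : ℝ) - 1)) 0 := by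
  unfold fA
  have h := (((hasDerivAt_id (0 : ℝ)).mul_const
    (a * ((i : ℝ) - 1) + b * ((N : ℝ) - (i : ℝ)))).div_const ((N : ℝ) - 1)).const_add 1
  simpa using h

lemma fB_deriv (c d : ℝ) (N i : ℕ) :
    HasDerivAt (fun w : ℝ => fB c d N w i)
      ((c * (i : ℝ) + d * ((N : ℝ) - (i : ℝ) - 1)) / ((N : ℝ) - 1)) 0 := by
  unfold fB
  have h := (((hasDerivAt_id (0 : ℝ)).mul_const
    (c * (i : ℝ) + d * ((N : ℝ) - (i : ℝ) - 1))).div_const ((N : ℝ) - 1)).const_add 1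
  simpa using h

lemma fA_zero (a b : ℝ) (N i : ℕ) : fA a b N 0 i = 1 := by simp [fA]

lemma fB_zero (c d : ℝ) (N i : ℕ) : fB c d N 0 i = 1 := by simp [fB]

lemma prod_deriv (a b c d : ℝ) (N k : ℕ) :
    HasDerivAt (fun w : ℝ => ∏ j ∈ Icc 1 k, fB c d N w j / fA a b N w j)
      (((c - d - a + b) * (k * (k + 1) / 2) + (d * ((N : ℝ) - 1) + a - b * N) * k)
        / ((N : ℝ) - 1)) 0 := by
  induction k with
  | zero => simpa using hasDerivAt_const (0 : ℝ) (1 : ℝ)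
  | succ k ih =>
    have h1 := (fB_deriv c d N (k + 1)).fun_div (fA_deriv a b N (k + 1)) (by simp [fA_zero])
    have h := ih.fun_mul h1
    simp only [fA_zero, fB_zero, div_one, prod_const_one, mul_one, one_mul, one_pow] at h
    simp only [prod_Icc_succ_top (Nat.le_add_left 1 k)]
    refine h.congr_deriv ?_
    push_cast
    ring

lemma sum_closed (u v : ℝ) (M : ℕ) :
    ∑ k ∈ Icc 1 M, (u * ((k : ℝ) * (k + 1) / 2) + v * k) =
      u * (M * (M + 1) * (M + 2) / 6) + v * (M * (M + 1) / 2) := by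
  induction M with
  | zero => simp
  | succ M ih =>
    rw [sum_Icc_succ_top (Nat.le_add_left 1 M), ih]
    push_cast
    ring

lemma rhoA_zero (a b c d : ℝ) (N : ℕ) (hN : 2 ≤ N) : rhoA a b c d N 0 = 1 / N := by
  have : ((N - 1 : ℕ) : ℝ) = N - 1 := by
    rw [Nat.cast_sub (by omega)]; simp
  simp [rhoA, fA_zero, fB_zero, this]

lemma rhoA_deriv (a b c d : ℝ) (N : ℕ) (hN : 2 ≤ N) :
    HasDerivAt (fun w : ℝ => rhoA a b c d N w)
      ((a + 2 * b - c - 2 * d) / 6 - (2 * a + b + c - 4 * d) / 6 / N) 0 := by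
  have hc : ((N - 1 : ℕ) : ℝ) = N - 1 := by
    rw [Nat.cast_sub (by omega)]; simp
  have hN2 : (2 : ℝ) ≤ N := by exact_mod_cast hN
  have h0 : (N : ℝ) ≠ 0 := by linarith
  have h1 : (N : ℝ) - 1 ≠ 0 := by linarith
  have hs := (HasDerivAt.fun_sum (u := Icc 1 (N - 1))
    (fun k _ => prod_deriv a b c d N k)).const_add 1
  have hv : (1 : ℝ) + ∑ k ∈ Icc 1 (N - 1), ∏ j ∈ Icc 1 k, fB c d N 0 j / fA a b N 0 j = N := by
    simp [fA_zero, fB_zero, hc]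
  have h := hs.fun_inv (by rw [hv]; exact h0)
  rw [hv, ← sum_div, sum_closed, hc] at h
  simp only [rhoA, one_div]
  refine h.congr_deriv ?_
  field_simp
  ring

/-- In the wN limit, ρ_A = 1/N + (w/6)(a + 2b − c − 2d) + o(w): the remainder
(ρ_A(N,w) − 1/N − (w/6)(a+2b−c−2d))/w has iterated limit 0, first w → 0⁺ then N → ∞. -/
theorem rhoA_wN_expansion (a b c d : ℝ) :
    ∃ g : ℕ → ℝ,
      (∀ N : ℕ, 2 ≤ N →
        Tendsto
          (fun w : ℝ =>
            (rhoA a b c d N w - 1 / (N : ℝ) - w / 6 * (a + 2 * b - c - 2 * d)) / w)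
          (𝓝[>] 0) (𝓝 (g N))) ∧
      Tendsto g atTop (𝓝 0) := by
  refine ⟨fun N => -((2 * a + b + c - 4 * d) / 6) / N, ?_, ?_⟩
  · intro N hN
    have h := (rhoA_deriv a b c d N hN).tendsto_slope_zero_right
    have h2 := h.sub_const ((a + 2 * b - c - 2 * d) / 6)
    have e : (a + 2 * b - c - 2 * d) / 6 - (2 * a + b + c - 4 * d) / 6 / N
        - (a + 2 * b - c - 2 * d) / 6 = -((2 * a + b + c - 4 * d) / 6) / N := by ring
    rw [e] at h2
    refine h2.congr' ?_
    filter_upwards [self_mem_nhdsWithin] with w hw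
    have hw0 : w ≠ 0 := ne_of_gt hw
    rw [zero_add, rhoA_zero a b c d N hN, smul_eq_mul]
    field_simp
  · exact tendsto_const_div_atTop_nhds_zero_nat _
end

section
/- Let a, b, c, d be real numbers and let N ≥ 2 be an integer. Then the fixation probability ρ_A(N,w) of the frequency-dependent Moran process under weak selection has the first-order expansion lim_{w→0⁺} (ρ_A(N,w) − 1/N)/w = (1/(6N))·(N(a + 2b − c − 2d) − (2a + b + c − 4d)). -/
open Filter Finset Topology

/-- Value and derivative at zero of the partial products. -/
lemma prod_hasDerivAt_aux (a b c d : ℝ) (N : ℕ) (k : ℕ) :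
    (∏ j ∈ Icc 1 k, fB c d N 0 j / fA a b N 0 j = 1) ∧
    HasDerivAt (fun w : ℝ => ∏ j ∈ Icc 1 k, fB c d N w j / fA a b N w j)
      (((c - a - d + b) * ((k : ℝ) * (k + 1) / 2) + (a - b * N + d * N - d) * k)
        / ((N : ℝ) - 1)) 0 := by
  induction k with
  | zero => simpa using hasDerivAt_const (0 : ℝ) (1 : ℝ)
  | succ k ih =>
    obtain ⟨h1, h2⟩ := ih
    have hA0 : fA a b N 0 (k + 1) = 1 := by simp [fA]
    have hB0 : fB c d N 0 (k + 1) = 1 := by simp [fB]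
    have lin : ∀ x : ℝ, HasDerivAt (fun w : ℝ => 1 + w * x / ((N : ℝ) - 1))
        (x / ((N : ℝ) - 1)) 0 := by
      intro x
      have := (((hasDerivAt_id (0 : ℝ)).mul_const x).div_const ((N : ℝ) - 1)).const_add 1
      simpa using this
    have hA : HasDerivAt (fun w => fA a b N w (k + 1)) _ 0 :=
      lin (a * (((k + 1 : ℕ) : ℝ) - 1) + b * ((N : ℝ) - ((k + 1 : ℕ) : ℝ)))
    have hB : HasDerivAt (fun w => fB c d N w (k + 1)) _ 0 :=
      lin (c * ((k + 1 : ℕ) : ℝ) + d * ((N : ℝ) - ((k + 1 : ℕ) : ℝ) - 1))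
    have hq := hB.fun_div hA (by rw [hA0]; exact one_ne_zero)
    have hp := h2.fun_mul hq
    simp only [Finset.prod_Icc_succ_top (Nat.le_add_left 1 k)]
    refine ⟨by rw [h1, hA0, hB0]; norm_num, ?_⟩
    refine hp.congr_deriv ?_
    rw [h1, hA0, hB0]
    push_cast
    ring

/-- Closed form for the double sum. -/
lemma sum_closed_aux (p q r : ℝ) (m : ℕ) :
    ∑ k ∈ Icc 1 m, ((p * ((k : ℝ) * (k + 1) / 2) + q * k) / r)
      = (p * ((m : ℝ) * (m + 1) * (m + 2) / 6) + q * (m * (m + 1) / 2)) / r := by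
  induction m with
  | zero => simp
  | succ m ih =>
    rw [Finset.sum_Icc_succ_top (Nat.le_add_left 1 m), ih]
    push_cast
    ring

/-- First-order weak-selection expansion of ρ_A at fixed population size N. -/
theorem rhoA_weak_selection_expansion (a b c d : ℝ) (N : ℕ) (hN : 2 ≤ N) :
    Tendsto (fun w : ℝ => (rhoA a b c d N w - 1 / (N : ℝ)) / w) (𝓝[>] 0)
      (𝓝 ((1 / (6 * (N : ℝ))) *
        ((N : ℝ) * (a + 2 * b - c - 2 * d) - (2 * a + b + c - 4 * d)))) := by
  obtain ⟨m, rfl⟩ : ∃ m, N = m + 1 := ⟨N - 1, by omega⟩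
  have hm : (m : ℝ) ≠ 0 := by
    have : m ≠ 0 := by omega
    exact_mod_cast this
  have hm1 : (m : ℝ) + 1 ≠ 0 := by positivity
  have hS := (HasDerivAt.fun_sum (u := Icc 1 m)
    (fun k _ => (prod_hasDerivAt_aux a b c d (m + 1) k).2)).const_add 1
  rw [sum_closed_aux] at hS
  have hS0 : (1 : ℝ) + ∑ k ∈ Icc 1 m,
      ∏ j ∈ Icc 1 k, fB c d (m + 1) 0 j / fA a b (m + 1) 0 j = m + 1 := by
    rw [Finset.sum_congr rfl (fun k _ => (prod_hasDerivAt_aux a b c d (m + 1) k).1)]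
    simp [add_comm]
  have hR := hS.fun_inv (by rw [hS0]; exact hm1)
  rw [hS0] at hR
  have hT := hR.tendsto_slope.mono_left
    (show 𝓝[>] (0 : ℝ) ≤ 𝓝[≠] 0 from
      nhdsWithin_mono (0 : ℝ) (fun x hx => ne_of_gt (Set.mem_Ioi.mp hx)))
  convert hT using 1
  · funext w
    rw [slope_def_field, hS0]
    simp [rhoA]
  · congr 1
    push_cast
    have e : (m : ℝ) + 1 - 1 = m := by ring
    rw [e]
    field_simp
    ring
end

section
/- Let a, b, c, d be real numbers. Then the statement ρ_A(N,w) > 1/N holds in the wN limit — that is, there exists N* such that for every integer N ≥ N* there exists w* > 0 such that ρ_A(N,w) > 1/N for all 0 < w < w* — if and only if one of the following holds: (i) a + 2b > c + 2d, or (ii) a + 2b = c + 2d and b > c. -/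
open Filter Finset Topology

lemma aux_inner (r p q : ℝ) (k : ℕ) :
    ∑ j ∈ Icc 1 k, (r * (j:ℝ)^2 + p * (j:ℝ) + q) =
      r * ((k:ℝ) * (k+1) * (2*k+1) / 6) + p * ((k:ℝ) * (k+1) / 2) + q * k := by
  induction k with
  | zero => simp
  | succ n ih =>
    rw [Finset.sum_Icc_succ_top (by omega), ih]
    push_cast
    ring

lemma aux_outer (r p q : ℝ) (M : ℕ) :
    ∑ k ∈ Icc 1 M, ∑ j ∈ Icc 1 k, (r * (j:ℝ)^2 + p * (j:ℝ) + q) =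
      r * ((M:ℝ) * (M+1)^2 * (M+2) / 12) + p * ((M:ℝ) * (M+1) * (M+2) / 6)
        + q * ((M:ℝ) * (M+1) / 2) := by
  induction M with
  | zero => simp
  | succ n ih =>
    rw [Finset.sum_Icc_succ_top (by omega), ih, aux_inner]
    push_cast
    ring

/-- scaled payoffs -/
noncomputable def yA (a b : ℝ) (N : ℕ) (i : ℕ) : ℝ :=
  (a * ((i : ℝ) - 1) + b * ((N : ℝ) - (i : ℝ))) / ((N : ℝ) - 1)

noncomputable def xB (c d : ℝ) (N : ℕ) (i : ℕ) : ℝ :=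
  (c * (i : ℝ) + d * ((N : ℝ) - (i : ℝ) - 1)) / ((N : ℝ) - 1)

lemma fA_eq (a b : ℝ) (N : ℕ) (w : ℝ) (i : ℕ) : fA a b N w i = 1 + w * yA a b N i := by
  unfold fA yA; ring

lemma fB_eq (c d : ℝ) (N : ℕ) (w : ℝ) (i : ℕ) : fB c d N w i = 1 + w * xB c d N i := by
  unfold fB xB; ring

/-- The sum in the denominator. -/
noncomputable def G (a b c d : ℝ) (N : ℕ) (w : ℝ) : ℝ :=
  ∑ k ∈ Icc 1 (N - 1), ∏ j ∈ Icc 1 k, fB c d N w j / fA a b N w j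

lemma hasDerivAt_ratio (x y : ℝ) :
    HasDerivAt (fun w : ℝ => (1 + w * x) / (1 + w * y)) (x - y) 0 := by
  have h1 : ∀ z : ℝ, HasDerivAt (fun w : ℝ => 1 + w * z) z 0 := fun z => by
    simpa using ((hasDerivAt_id (0:ℝ)).mul_const z).const_add 1
  have := (h1 x).fun_div (h1 y) (by simp)
  simpa using this

lemma hasDerivAt_G (a b c d : ℝ) (N : ℕ) :
    HasDerivAt (G a b c d N)
      (∑ k ∈ Icc 1 (N - 1), ∑ j ∈ Icc 1 k, (xB c d N j - yA a b N j)) 0 := by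
  unfold G
  simp only [fA_eq, fB_eq]
  refine HasDerivAt.fun_sum fun k _ => ?_
  have := HasDerivAt.fun_finsetProd (u := Icc 1 k) (x := (0:ℝ))
    (f := fun j w => (1 + w * xB c d N j) / (1 + w * yA a b N j))
    (f' := fun j => xB c d N j - yA a b N j) (fun j _ => hasDerivAt_ratio _ _)
  simpa using this

lemma G_zero (a b c d : ℝ) (N : ℕ) (hN : 2 ≤ N) : G a b c d N 0 = N - 1 := by
  unfold G
  simp only [fA_eq, fB_eq]
  simp
  rw [Nat.cast_sub (by omega)]; simp

lemma S_eq (a b c d : ℝ) (N : ℕ) (hN : 2 ≤ N) :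
    ∑ k ∈ Icc 1 (N - 1), ∑ j ∈ Icc 1 k, (xB c d N j - yA a b N j) =
      - (N / 6) * (N * (a + 2 * b - (c + 2 * d)) + (-2*a - b - c + 4*d)) := by
  obtain ⟨M, rfl⟩ : ∃ M, N = M + 1 := ⟨N - 1, by omega⟩
  have hM : (M:ℝ) ≠ 0 := by
    have : M ≠ 0 := by omega
    exact_mod_cast this
  have h : ∀ j : ℕ, xB c d (M+1) j - yA a b (M+1) j =
      0 * (j:ℝ)^2 + ((c - d - a + b) / M) * j + (d * M + a - b * (M+1)) / M := by
    intro j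
    unfold xB yA
    push_cast
    rw [add_sub_cancel_right]
    field_simp
    ring
  simp only [h]
  rw [show M + 1 - 1 = M by omega, aux_outer]
  push_cast
  field_simp
  ring

lemma tendsto_log_aux (x : ℝ) :
    Tendsto (fun w : ℝ => (Real.log (1 + w * x) - w * x) / w^2) (𝓝[>] 0) (𝓝 (-x^2/2)) := by
  rw [tendsto_iff_norm_sub_tendsto_zero]
  have hlim : Tendsto (fun w : ℝ => 2 * |x|^3 * w) (𝓝[>] 0) (𝓝 0) := by
    have : Tendsto (fun w : ℝ => 2 * |x|^3 * w) (𝓝 0) (𝓝 (2 * |x|^3 * 0)) :=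
      (continuous_const.mul continuous_id).tendsto 0
    rw [mul_zero] at this
    exact this.mono_left nhdsWithin_le_nhds
  refine squeeze_zero' (Eventually.of_forall fun _ => norm_nonneg _) ?_ hlim
  have hs : ∀ᶠ w : ℝ in 𝓝[>] 0, |w * x| < 1/2 := by
    have : Tendsto (fun w : ℝ => |w * x|) (𝓝 0) (𝓝 (|0 * x|)) :=
      ((continuous_id.mul continuous_const).abs).tendsto 0
    simp only [zero_mul, abs_zero] at this
    exact (this.mono_left nhdsWithin_le_nhds).eventually (gt_mem_nhds (by norm_num))
  filter_upwards [hs, self_mem_nhdsWithin] with w hw hpos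
  have hpos : 0 < w := hpos
  have h := Real.abs_log_sub_add_sum_range_le (x := -(w*x)) (by rw [abs_neg]; linarith) 2
  simp only [Finset.sum_range_succ, Finset.sum_range_zero, abs_neg, sub_neg_eq_add] at h
  norm_num at h
  have h2 : |w * x|^3 / (1 - |w*x|) ≤ 2 * |w*x|^3 := by
    rw [div_le_iff₀ (by linarith)]
    nlinarith [pow_nonneg (abs_nonneg (w*x)) 3]
  have e : (Real.log (1 + w * x) - w * x) / w^2 - -x^2/2 =
     (-(w*x) + (w*x)^2/2 + Real.log (1 + w*x)) / w^2 := by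
    field_simp
    ring
  rw [e, Real.norm_eq_abs, abs_div, abs_of_pos (pow_pos hpos 2), div_le_iff₀ (pow_pos hpos 2)]
  rw [abs_mul, abs_of_pos hpos] at h2
  rw [abs_of_pos hpos] at h
  calc _ ≤ _ := h
    _ ≤ _ := h2
    _ = _ := by ring

lemma eventually_pos (x : ℝ) : ∀ᶠ w : ℝ in 𝓝[>] 0, 0 < 1 + w * x := by
  have : Tendsto (fun w : ℝ => 1 + w * x) (𝓝 0) (𝓝 (1 + 0 * x)) :=
    (continuous_const.add (continuous_id.mul continuous_const)).tendsto 0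
  exact (this.mono_left nhdsWithin_le_nhds).eventually (lt_mem_nhds (by norm_num))

/-- Degenerate case. -/
lemma degenerate (a b c d : ℝ) (N : ℕ) (hN : 3 ≤ N) (h1 : a + 2 * b = c + 2 * d) (h2 : b = c) :
    ∀ᶠ w : ℝ in 𝓝[>] 0, (N:ℝ) - 1 ≤ G a b c d N w := by
  subst h2
  have ha : a = 2 * d - b := by linarith
  by_cases hbd : b = d
  · subst hbd
    have ha : a = b := by linarith
    subst ha
    have key : ∀ j : ℕ, xB a a N j = yA a a N j := by
      intro j; unfold xB yA; ring
    have : ∀ᶠ w : ℝ in 𝓝[>] 0, ∀ j ∈ Icc 1 N, 0 < 1 + w * yA a a N j :=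
      (Finset.eventually_all _).2 fun j _ => eventually_pos _
    filter_upwards [this] with w hw
    apply le_of_eq
    rw [← G_zero a a a a N (by omega)]
    unfold G
    refine Finset.sum_congr rfl fun k hk => Finset.prod_congr rfl fun j hj => ?_
    simp only [Finset.mem_Icc] at hk hj
    have := hw j (by simp only [Finset.mem_Icc]; omega)
    rw [fA_eq, fB_eq, fA_eq, fB_eq, key, div_self this.ne']
    simp
  have hS := S_eq a b b d N (by omega)
  have hS0 : ∑ k ∈ Icc 1 (N - 1), ∑ j ∈ Icc 1 k, (xB b d N j - yA a b N j) = 0 := by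
    rw [hS, ha]; ring
  have hE : 0 < ∑ k ∈ Icc 1 (N - 1), ∑ j ∈ Icc 1 k,
      (-(xB b d N j)^2/2 - -(yA a b N j)^2/2) := by
    obtain ⟨M, rfl⟩ : ∃ M, N = M + 1 := ⟨N - 1, by omega⟩
    have hM : (2:ℝ) ≤ M := by
      have : 2 ≤ M := by omega
      exact_mod_cast this
    have hM0 : (M:ℝ) ≠ 0 := by linarith
    have h : ∀ j : ℕ, -(xB b d (M+1) j)^2/2 - -(yA a b (M+1) j)^2/2 =
      (3 * (b-d)^2 / (2 * M^2)) * (j:ℝ)^2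
       + (-((b-d) * (3 * ((d+b)*(M+1) - 3*d + b) + (b-d)*(M+2))) / (2*M^2)) * j
       + ((b-d)*(M+2)*((d+b)*(M+1) - 3*d + b)) / (2*M^2) := by
      intro j
      unfold xB yA
      rw [ha]
      push_cast
      rw [add_sub_cancel_right]
      field_simp
      ring
    simp only [h]
    rw [show M + 1 - 1 = M by omega, aux_outer]
    have e : (3 * (b-d)^2 / (2 * M^2)) * ((M:ℝ) * (M+1)^2 * (M+2) / 12)
       + (-((b-d) * (3 * ((d+b)*(M+1) - 3*d + b) + (b-d)*(M+2))) / (2*M^2))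
          * ((M:ℝ) * (M+1) * (M+2) / 6)
       + ((b-d)*(M+2)*((d+b)*(M+1) - 3*d + b)) / (2*M^2) * ((M:ℝ) * (M+1) / 2)
       = (b-d)^2 * (M+1) * (M+2) * (M-1) / (24 * M) := by
      field_simp
      ring
    rw [e]
    have : 0 < (b-d)^2 := by
      have : b - d ≠ 0 := sub_ne_zero.2 hbd
      positivity
    have : (0:ℝ) < M - 1 := by linarith
    have : (0:ℝ) < M := by linarith
    positivity
  have hT : Tendsto (fun w : ℝ => ∑ k ∈ Icc 1 (N - 1), ∑ j ∈ Icc 1 k,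
      ((Real.log (1 + w * xB b d N j) - w * xB b d N j) / w^2
        - (Real.log (1 + w * yA a b N j) - w * yA a b N j) / w^2)) (𝓝[>] 0)
      (𝓝 (∑ k ∈ Icc 1 (N - 1), ∑ j ∈ Icc 1 k,
      (-(xB b d N j)^2/2 - -(yA a b N j)^2/2))) :=
    tendsto_finsetSum _ fun k _ => tendsto_finsetSum _ fun j _ =>
      (tendsto_log_aux _).sub (tendsto_log_aux _)
  have hpA : ∀ᶠ w : ℝ in 𝓝[>] 0, ∀ j ∈ Icc 1 N, 0 < 1 + w * yA a b N j :=
      (Finset.eventually_all _).2 fun j _ => eventually_pos _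
  have hpB : ∀ᶠ w : ℝ in 𝓝[>] 0, ∀ j ∈ Icc 1 N, 0 < 1 + w * xB b d N j :=
      (Finset.eventually_all _).2 fun j _ => eventually_pos _
  filter_upwards [hpA, hpB, hT.eventually (lt_mem_nhds hE), self_mem_nhdsWithin]
    with w hA hB hw hpos
  have hpos : 0 < w := hpos
  have e : ∀ j, (Real.log (1 + w * xB b d N j) - w * xB b d N j) / w^2
        - (Real.log (1 + w * yA a b N j) - w * yA a b N j) / w^2
      = (1/w^2) * (Real.log (1 + w * xB b d N j) - Real.log (1 + w * yA a b N j))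
        - (1/w) * (xB b d N j - yA a b N j) := by
    intro j; field_simp; ring
  simp only [e, Finset.sum_sub_distrib, ← Finset.mul_sum] at hw
  simp only [Finset.sum_sub_distrib] at hS0
  rw [hS0, mul_zero, sub_zero] at hw
  have hL := (pos_iff_pos_of_mul_pos hw).1 (by positivity)
  rw [← Finset.sum_sub_distrib] at hL
  have hG : ∑ k ∈ Icc 1 (N - 1), (1 + (∑ j ∈ Icc 1 k, Real.log (1 + w * xB b d N j)
      - ∑ j ∈ Icc 1 k, Real.log (1 + w * yA a b N j))) ≤ G a b b d N w := by
    unfold G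
    refine Finset.sum_le_sum fun k hk => ?_
    simp only [Finset.mem_Icc] at hk
    have hm : ∀ j ∈ Icc 1 k, j ∈ Icc 1 N := by
      intro j hj
      simp only [Finset.mem_Icc] at hj ⊢
      omega
    simp only [fA_eq, fB_eq]
    have hp : 0 < ∏ j ∈ Icc 1 k, (1 + w * xB b d N j) / (1 + w * yA a b N j) :=
      Finset.prod_pos fun j hj => div_pos (hB j (hm j hj)) (hA j (hm j hj))
    have hl := Real.log_le_sub_one_of_pos hp
    rw [Real.log_prod (fun j hj => (div_pos (hB j (hm j hj)) (hA j (hm j hj))).ne'),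
      Finset.sum_congr rfl (fun j hj =>
        Real.log_div (hB j (hm j hj)).ne' (hA j (hm j hj)).ne'), Finset.sum_sub_distrib] at hl
    linarith
  rw [Finset.sum_add_distrib] at hG
  have hc : ∑ k ∈ Icc 1 (N - 1), (1:ℝ) = N - 1 := by
    simp
    rw [Nat.cast_sub (by omega)]; simp
  rw [hc] at hG
  linarith

lemma deriv_neg_case (f : ℝ → ℝ) (f' : ℝ) (h : HasDerivAt f f' 0) (hf : f' < 0) :
    ∀ᶠ w : ℝ in 𝓝[>] 0, f w < f 0 := by
  have ht := (hasDerivAt_iff_tendsto_slope.1 h).mono_left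
    (nhdsWithin_mono (0:ℝ) (fun x (hx : x ∈ Set.Ioi (0:ℝ)) => (ne_of_gt hx : x ≠ 0)))
  filter_upwards [ht.eventually (gt_mem_nhds hf), self_mem_nhdsWithin] with w hw hpos
  have hpos : 0 < w := hpos
  rw [slope_def_field, sub_zero, div_lt_iff₀ hpos] at hw
  linarith

lemma rho_gt_of (a b c d : ℝ) (N : ℕ) (hN : 2 ≤ N)
    (hT : 0 < N * (a + 2 * b - (c + 2 * d)) + (-2*a - b - c + 4*d)) :
    ∀ᶠ w : ℝ in 𝓝[>] 0, rhoA a b c d N w > 1 / (N : ℝ) := by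
  have hd := hasDerivAt_G a b c d N
  have hN' : (2:ℝ) ≤ N := by exact_mod_cast hN
  have h0 := G_zero a b c d N hN
  have h1 := deriv_neg_case _ _ hd (by
    rw [S_eq a b c d N hN]
    have : 0 < (N:ℝ) / 6 := by linarith
    nlinarith [mul_pos this hT])
  have h2 : ∀ᶠ w : ℝ in 𝓝[>] 0, 0 < G a b c d N w := by
    refine (hd.continuousAt.tendsto.mono_left nhdsWithin_le_nhds).eventually (lt_mem_nhds ?_)
    rw [h0]; linarith
  filter_upwards [h1, h2] with w h1 h2
  change 1 / (1 + G a b c d N w) > 1 / (N:ℝ)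
  rw [h0] at h1
  exact one_div_lt_one_div_of_lt (by linarith) (by linarith)

lemma G_ge_of (a b c d : ℝ) (N : ℕ) (hN : 2 ≤ N)
    (hT : N * (a + 2 * b - (c + 2 * d)) + (-2*a - b - c + 4*d) < 0) :
    ∀ᶠ w : ℝ in 𝓝[>] 0, (N:ℝ) - 1 ≤ G a b c d N w := by
  have hd := (hasDerivAt_G a b c d N).fun_neg
  have hN' : (2:ℝ) ≤ N := by exact_mod_cast hN
  have h0 := G_zero a b c d N hN
  have h1 := deriv_neg_case _ _ hd (by
    rw [S_eq a b c d N hN]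
    have : 0 < (N:ℝ) / 6 := by linarith
    nlinarith [mul_neg_of_pos_of_neg this hT])
  filter_upwards [h1] with w h1
  rw [h0] at h1
  linarith

lemma exists_large (α β : ℝ) (hα : 0 < α) : ∃ K : ℕ, ∀ N : ℕ, K ≤ N → 0 < N * α + β := by
  obtain ⟨K, hK⟩ := exists_nat_gt (-β / α)
  refine ⟨K, fun N hN => ?_⟩
  have : (K:ℝ) ≤ N := by exact_mod_cast hN
  rw [div_lt_iff₀ hα] at hK
  nlinarith

/-- In the wN limit, ρ_A > 1/N iff a + 2b > c + 2d, or a + 2b = c + 2d and b > c. -/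
theorem rhoA_gt_neutral_wN (a b c d : ℝ) :
    (∃ N₀ : ℕ, ∀ N : ℕ, N₀ ≤ N → ∃ w' > (0 : ℝ), ∀ w : ℝ, 0 < w → w < w' →
        rhoA a b c d N w > 1 / (N : ℝ)) ↔
      (a + 2 * b > c + 2 * d ∨ (a + 2 * b = c + 2 * d ∧ b > c)) := by
  constructor
  · rintro ⟨N₀, hN₀⟩
    by_contra hcon
    push Not at hcon
    obtain ⟨hle, himp⟩ := hcon
    have key : ∃ N : ℕ, N₀ ≤ N ∧ 2 ≤ N ∧ ∀ᶠ w : ℝ in 𝓝[>] 0, (N:ℝ) - 1 ≤ G a b c d N w := by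
      rcases hle.lt_or_eq with hlt | heq
      · obtain ⟨K, hK⟩ := exists_large (c + 2 * d - (a + 2 * b)) (-(-2*a - b - c + 4*d))
          (by linarith)
        refine ⟨max N₀ (max K 2), by omega, by omega, ?_⟩
        apply G_ge_of _ _ _ _ _ (by omega)
        have := hK (max N₀ (max K 2)) (by omega)
        linarith
      · rcases (himp heq).lt_or_eq with hlt | hbc
        · refine ⟨max N₀ 2, by omega, by omega, ?_⟩
          apply G_ge_of _ _ _ _ _ (by omega)
          rw [heq, sub_self, mul_zero]
          linarith
        · exact ⟨max N₀ 3, by omega, by omega, degenerate a b c d _ (by omega) heq hbc⟩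
    obtain ⟨N, h1, h2, h3⟩ := key
    obtain ⟨w', hw', hw⟩ := hN₀ N h1
    have hI : ∀ᶠ w : ℝ in 𝓝[>] 0, w ∈ Set.Ioo 0 w' := Ioo_mem_nhdsGT hw'
    obtain ⟨w, hwG, hwI⟩ := (h3.and hI).exists
    have := hw w hwI.1 hwI.2
    change 1 / (1 + G a b c d N w) > 1 / (N:ℝ) at this
    have hN' : (2:ℝ) ≤ N := by exact_mod_cast h2
    have := one_div_le_one_div_of_le (a := (N:ℝ)) (b := 1 + G a b c d N w)
      (by linarith) (by linarith)
    linarith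
  · intro h
    have key : ∃ K : ℕ, ∀ N : ℕ, K ≤ N →
        0 < N * (a + 2 * b - (c + 2 * d)) + (-2*a - b - c + 4*d) := by
      rcases h with h | ⟨h, hbc⟩
      · exact exists_large _ _ (by linarith)
      · refine ⟨0, fun N _ => ?_⟩
        rw [h, sub_self, mul_zero]
        linarith
    obtain ⟨K, hK⟩ := key
    refine ⟨max K 2, fun N hN => ?_⟩
    have := rho_gt_of a b c d N (by omega) (hK N (by omega))
    obtain ⟨u, hu, hsub⟩ := mem_nhdsGT_iff_exists_Ioo_subset.1 this
    exact ⟨u, hu, fun w h0 h1 => hsub ⟨h0, h1⟩⟩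
end

section
/- Let a, b, c, d be real numbers with a + 2b = c + 2d and b = c, and let N > 2 be an integer. Then the fixation probability ρ_A(N,w) of the frequency-dependent Moran process under weak selection satisfies lim_{w→0⁺} (ρ_A(N,w) − 1/N)/w² = −(a − b)²·(N+2)(N+1)(N−2)/(240·N·(N−1)). In particular, if additionally a ≠ b, then ρ_A(N,w) < 1/N for all sufficiently small w > 0. -/
open Filter Finset Topology

/-- Second-order expansion `f w = c + p w + w² (q + o(1))` as `w → 0⁺`. -/
def Exp2 (f : ℝ → ℝ) (c p q : ℝ) : Prop :=
  ∃ g : ℝ → ℝ, Tendsto g (𝓝[>] 0) (𝓝 q) ∧ ∀ᶠ w in 𝓝[>] (0 : ℝ), f w = c + p * w + w ^ 2 * g w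

lemma tendsto_id_right : Tendsto (fun w : ℝ => w) (𝓝[>] 0) (𝓝 0) :=
  tendsto_id.mono_left nhdsWithin_le_nhds

lemma Exp2.add {f₁ f₂ : ℝ → ℝ} {c₁ p₁ q₁ c₂ p₂ q₂ : ℝ} (h₁ : Exp2 f₁ c₁ p₁ q₁)
    (h₂ : Exp2 f₂ c₂ p₂ q₂) : Exp2 (fun w => f₁ w + f₂ w) (c₁ + c₂) (p₁ + p₂) (q₁ + q₂) := by
  obtain ⟨g₁, t₁, e₁⟩ := h₁
  obtain ⟨g₂, t₂, e₂⟩ := h₂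
  refine ⟨fun w => g₁ w + g₂ w, t₁.add t₂, ?_⟩
  filter_upwards [e₁, e₂] with w hw₁ hw₂
  rw [hw₁, hw₂]; ring

lemma Exp2.mul {f₁ f₂ : ℝ → ℝ} {p₁ q₁ p₂ q₂ : ℝ} (h₁ : Exp2 f₁ 1 p₁ q₁)
    (h₂ : Exp2 f₂ 1 p₂ q₂) :
    Exp2 (fun w => f₁ w * f₂ w) 1 (p₁ + p₂) (q₁ + q₂ + p₁ * p₂) := by
  obtain ⟨g₁, t₁, e₁⟩ := h₁
  obtain ⟨g₂, t₂, e₂⟩ := h₂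
  refine ⟨fun w => g₁ w + g₂ w + p₁ * p₂ + w * (p₁ * g₂ w + p₂ * g₁ w)
    + w * (w * (g₁ w * g₂ w)), ?_, ?_⟩
  · have hw := tendsto_id_right
    have := (((t₁.add t₂).add_const (p₁ * p₂)).add
      (hw.mul ((t₂.const_mul p₁).add (t₁.const_mul p₂)))).add (hw.mul (hw.mul (t₁.mul t₂)))
    simpa using this
  · filter_upwards [e₁, e₂] with w hw₁ hw₂
    rw [hw₁, hw₂]; ring

lemma exp2_ratio (α β : ℝ) :
    Exp2 (fun w => (1 + w * β) / (1 + w * α)) 1 (β - α) (-(α * (β - α))) := by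
  have ht : Tendsto (fun w : ℝ => 1 + w * α) (𝓝[>] 0) (𝓝 1) := by
    simpa using (tendsto_id_right.mul_const α).const_add 1
  refine ⟨fun w => -(α * (β - α)) / (1 + w * α), ?_, ?_⟩
  · have := (tendsto_const_nhds (x := -(α * (β - α)))).div ht one_ne_zero
    rwa [div_one] at this
  · filter_upwards [ht.eventually_ne one_ne_zero] with w hw
    field_simp
    ring

lemma Exp2.cast {f : ℝ → ℝ} {c p q c' p' q' : ℝ} (h : Exp2 f c p q)
    (hc : c = c') (hp : p = p') (hq : q = q') : Exp2 f c' p' q' := by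
  subst hc hp hq; exact h

lemma exp2_prod (u b N : ℝ) (k : ℕ) :
    Exp2 (fun w => ∏ j ∈ Icc 1 k,
      (1 + w * (b + u * (N - 1 - (j : ℝ)) / 2)) / (1 + w * (b + u * ((j : ℝ) - 1)))) 1
      (u * k * (2 * N - 1 - 3 * k) / 4)
      ((u * k * (2 * N - 1 - 3 * k) / 4) ^ 2 / 2 - b * (u * k * (2 * N - 1 - 3 * k) / 4)
        - u ^ 2 / 8 * ((N + 1) * (N - 3) * k + (5 - N) * k * (k + 1)
          - k * (k + 1) * (2 * k + 1) / 2)) := by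
  induction k with
  | zero =>
    refine ⟨fun _ => 0, ?_, ?_⟩
    · simp
    · simp
  | succ k ih =>
    have h := ih.mul (exp2_ratio (b + u * (((k + 1 : ℕ) : ℝ) - 1))
      (b + u * (N - 1 - ((k + 1 : ℕ) : ℝ)) / 2))
    simp only [Finset.prod_Icc_succ_top (Nat.le_add_left 1 k)]
    refine h.cast rfl ?_ ?_
    · push_cast; ring
    · push_cast; ring

lemma exp2_sum (u b N : ℝ) (n : ℕ) :
    Exp2 (fun w => 1 + ∑ k ∈ Icc 1 n, ∏ j ∈ Icc 1 k,
      (1 + w * (b + u * (N - 1 - (j : ℝ)) / 2)) / (1 + w * (b + u * ((j : ℝ) - 1)))) (n + 1)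
      (u * n * (n + 1) * (N - 1 - n) / 4)
      (u ^ 2 / 32 * ((2 * N - 1) ^ 2 * (n * (n + 1) * (2 * n + 1) / 6)
          - 6 * (2 * N - 1) * (n ^ 2 * (n + 1) ^ 2 / 4)
          + 9 * (n * (n + 1) * (2 * n + 1) * (3 * n ^ 2 + 3 * n - 1) / 30))
        - b * (u * n * (n + 1) * (N - 1 - n) / 4)
        - u ^ 2 / 8 * ((N + 1) * (N - 3) * (n * (n + 1) / 2) + (5 - N) * (n * (n + 1) * (n + 2) / 3)
          - (2 * (n ^ 2 * (n + 1) ^ 2 / 4) + 3 * (n * (n + 1) * (2 * n + 1) / 6)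
            + n * (n + 1) / 2) / 2)) := by
  induction n with
  | zero =>
    refine ⟨fun _ => 0, ?_, ?_⟩
    · simp
    · simp
  | succ n ih =>
    have h := ih.add (exp2_prod u b N (n + 1))
    simp only [Finset.sum_Icc_succ_top (Nat.le_add_left 1 n), ← add_assoc]
    refine h.cast ?_ ?_ ?_
    · push_cast; ring
    · push_cast; ring
    · push_cast; ring

/-- Border case a + 2b = c + 2d, b = c: second-order expansion of ρ_A,
and ρ_A < 1/N for small w when additionally a ≠ b. -/
theorem rhoA_border_second_order (a b c d : ℝ) (h1 : a + 2 * b = c + 2 * d) (h2 : b = c)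
    (N : ℕ) (hN : 2 < N) :
    Tendsto (fun w : ℝ => (rhoA a b c d N w - 1 / (N : ℝ)) / w ^ 2) (𝓝[>] 0)
      (𝓝 (-((a - b) ^ 2 * ((N : ℝ) + 2) * ((N : ℝ) + 1) * ((N : ℝ) - 2) /
        (240 * (N : ℝ) * ((N : ℝ) - 1))))) ∧
    (a ≠ b → ∀ᶠ w in 𝓝[>] (0 : ℝ), rhoA a b c d N w < 1 / (N : ℝ)) := by
  subst h2
  obtain rfl : d = (a + b) / 2 := by linarith
  have hN' : (2 : ℝ) < N := by exact_mod_cast hN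
  have hM : (N : ℝ) - 1 ≠ 0 := by linarith
  have hN0 : (N : ℝ) ≠ 0 := by linarith
  have hcast : ((N - 1 : ℕ) : ℝ) = N - 1 := by
    rw [Nat.cast_sub (by omega)]; simp
  have hA : ∀ w j, fA a b N w j = 1 + w * (b + (a - b) / ((N : ℝ) - 1) * ((j : ℝ) - 1)) := by
    intro w j
    unfold fA
    field_simp
    ring
  have hB : ∀ w j, fB b ((a + b) / 2) N w j
      = 1 + w * (b + (a - b) / ((N : ℝ) - 1) * ((N : ℝ) - 1 - (j : ℝ)) / 2) := by
    intro w j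
    unfold fB
    field_simp
    ring
  have key := (exp2_sum ((a - b) / ((N : ℝ) - 1)) b N (N - 1)).cast (c' := N) (p' := 0)
    (q' := (N : ℝ) ^ 2 * ((a - b) ^ 2 * ((N : ℝ) + 2) * ((N : ℝ) + 1) * ((N : ℝ) - 2) /
        (240 * (N : ℝ) * ((N : ℝ) - 1))))
    (by rw [hcast]; ring) (by rw [hcast]; ring) (by rw [hcast]; field_simp; ring)
  obtain ⟨g, tg, eg⟩ := key
  have hden : Tendsto (fun w : ℝ => (N : ℝ) + w ^ 2 * g w) (𝓝[>] 0) (𝓝 N) := by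
    simpa using ((tendsto_id_right.pow 2).mul tg).const_add (N : ℝ)
  have hlim : Tendsto (fun w : ℝ => (rhoA a b b ((a + b) / 2) N w - 1 / (N : ℝ)) / w ^ 2) (𝓝[>] 0)
      (𝓝 (-((a - b) ^ 2 * ((N : ℝ) + 2) * ((N : ℝ) + 1) * ((N : ℝ) - 2) /
        (240 * (N : ℝ) * ((N : ℝ) - 1))))) := by
    have h := tg.neg.div (hden.const_mul (N : ℝ)) (mul_ne_zero hN0 hN0)
    have e : ∀ X : ℝ, -((N : ℝ) ^ 2 * X) / ((N : ℝ) * N) = -X := by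
      intro X; field_simp
    rw [e] at h
    refine h.congr' ?_
    filter_upwards [eg, hden.eventually_ne hN0, self_mem_nhdsWithin] with w hw hd hpos
    have hw0 : w ≠ 0 := ne_of_gt hpos
    unfold rhoA
    simp only [hA, hB]
    rw [hw, zero_mul, add_zero]
    simp only [Pi.div_apply]
    rw [div_sub_div _ _ hd hN0, div_div, div_eq_div_iff (mul_ne_zero hN0 hd)
      (mul_ne_zero (mul_ne_zero hd hN0) (pow_ne_zero 2 hw0))]
    ring
  refine ⟨hlim, fun hab => ?_⟩
  have hneg : -((a - b) ^ 2 * ((N : ℝ) + 2) * ((N : ℝ) + 1) * ((N : ℝ) - 2) /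
        (240 * (N : ℝ) * ((N : ℝ) - 1))) < 0 := by
    have h1 : 0 < (a - b) ^ 2 := by
      have := sub_ne_zero.mpr hab
      positivity
    have h2 : 0 < (N : ℝ) - 2 := by linarith
    have h3 : 0 < (N : ℝ) - 1 := by linarith
    have h4 : 0 < (N : ℝ) := by linarith
    rw [neg_lt_zero]
    positivity
  filter_upwards [hlim.eventually_lt_const hneg, self_mem_nhdsWithin] with w hw hpos
  have hw2 : 0 < w ^ 2 := pow_pos hpos 2
  have := (div_lt_iff₀ hw2).mp hw
  linarith
end

section
/- Let a, b, c, d be real numbers and let N ≥ 2 be an integer. Define P(N,w) = Π_{j=1}^{N−1} f_A(j)/f_B(j), where f_A(i) = 1 + w·(a(i−1)+b(N−i))/(N−1) and f_B(i) = 1 + w·(ci+d(N−i−1))/(N−1). Then lim_{w→0⁺} (P(N,w) − 1)/w = (1/2)·(N(a + b − c − d) − 2a + 2d). -/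
open Filter Finset Topology

lemma prod_hasDerivAt_aux_s5 (s : Finset ℕ) (g : ℕ → ℝ → ℝ) (g' : ℕ → ℝ)
    (h0 : ∀ j, g j 0 = 1) (h : ∀ j, HasDerivAt (g j) (g' j) 0) :
    HasDerivAt (fun w => ∏ j ∈ s, g j w) (∑ j ∈ s, g' j) 0 := by
  induction s using Finset.induction_on with
  | empty => simpa using hasDerivAt_const (0 : ℝ) (1 : ℝ)
  | insert j s hj ih =>
    simp only [Finset.prod_insert hj, Finset.sum_insert hj]
    have := (h j).fun_mul ih
    simpa [h0] using this

lemma sum_aux (p q : ℝ) (n : ℕ) :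
    ∑ j ∈ Icc 1 n, (p * (j : ℝ) + q) = p * ((n : ℝ) * (n + 1) / 2) + q * n := by
  induction n with
  | zero => simp
  | succ n ih =>
    rw [Finset.sum_Icc_succ_top (by omega), ih]
    push_cast
    ring

lemma affine_aux (x y : ℝ) : HasDerivAt (fun w : ℝ => 1 + w * x / y) (x / y) 0 := by
  have := (((hasDerivAt_id (0 : ℝ)).mul_const x).div_const y).const_add 1
  simpa using this

/-- First-order weak-selection expansion of the ratio ρ_A/ρ_B = Π f_A(j)/f_B(j). -/
theorem ratio_weak_selection_expansion (a b c d : ℝ) (N : ℕ) (hN : 2 ≤ N) :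
    Tendsto
      (fun w : ℝ => ((∏ j ∈ Icc 1 (N - 1), fA a b N w j / fB c d N w j) - 1) / w)
      (𝓝[>] 0)
      (𝓝 ((1 / 2) * ((N : ℝ) * (a + b - c - d) - 2 * a + 2 * d))) := by
  obtain ⟨n, rfl⟩ : ∃ n, N = n + 1 := ⟨N - 1, by omega⟩
  have hn : (n : ℝ) ≠ 0 := by
    have : n ≠ 0 := by omega
    exact_mod_cast this
  set g' : ℕ → ℝ := fun j =>
    (a * ((j : ℝ) - 1) + b * (((n + 1 : ℕ) : ℝ) - (j : ℝ))) / (((n + 1 : ℕ) : ℝ) - 1)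
      - (c * (j : ℝ) + d * (((n + 1 : ℕ) : ℝ) - (j : ℝ) - 1)) / (((n + 1 : ℕ) : ℝ) - 1) with hg'
  have key := prod_hasDerivAt_aux_s5 (Icc 1 (n + 1 - 1))
    (fun j w => fA a b (n + 1) w j / fB c d (n + 1) w j) g'
    (fun j => by simp [fA, fB])
    (fun j => by
      have hA : HasDerivAt (fun w => fA a b (n + 1) w j) _ 0 := affine_aux _ _
      have hB : HasDerivAt (fun w => fB c d (n + 1) w j) _ 0 := affine_aux _ _
      have hA0 : fA a b (n + 1) 0 j = 1 := by simp [fA]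
      have hB0 : fB c d (n + 1) 0 j = 1 := by simp [fB]
      have := hA.fun_div hB (by rw [hB0]; exact one_ne_zero)
      rw [hA0, hB0] at this
      refine this.congr_deriv ?_
      simp only [hg']
      ring)
  have hsum : ∑ j ∈ Icc 1 (n + 1 - 1), g' j
      = (1 / 2) * (((n + 1 : ℕ) : ℝ) * (a + b - c - d) - 2 * a + 2 * d) := by
    have h1 : ∀ j ∈ Icc 1 (n + 1 - 1), g' j
        = ((a - b - c + d) / n) * (j : ℝ) + (b * (n + 1) - a - d * n) / n := by
      intro j _
      simp only [hg']
      push_cast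
      rw [add_sub_cancel_right]
      ring
    rw [Finset.sum_congr rfl h1, Nat.add_sub_cancel, sum_aux]
    push_cast
    field_simp
    ring
  rw [hsum] at key
  have ht := key.tendsto_slope_zero_right
  refine ht.congr fun w => ?_
  have h1 : ∏ j ∈ Icc 1 (n + 1 - 1), fA a b (n + 1) 0 j / fB c d (n + 1) 0 j = 1 :=
    Finset.prod_eq_one fun j _ => by simp [fA, fB]
  simp only [zero_add, smul_eq_mul, h1]
  rw [div_eq_inv_mul]
end

section
/- Let a, b, c, d be real numbers, and for w > 0 small enough that all fitnesses are positive let L(w) = lim_{N→∞} ρ_A(N,w) denote the large-population limit of the weak-selection Moran fixation probability. If b ≤ d, or if b > d and a + b < c + d, then L(w) exists for all sufficiently small w > 0 and lim_{w→0⁺} L(w)/w = 0. If b > d and a + b > c + d, then L(w) exists for all sufficiently small w > 0 and lim_{w→0⁺} L(w)/w = b − d; in particular ρ_A ~ (b−d)·w + o(w) in the Nw limit. -/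
open Filter Finset Topology

/-- Partial products of the fitness ratios. -/
noncomputable def prodR (a b c d : ℝ) (N : ℕ) (w : ℝ) (k : ℕ) : ℝ :=
  ∏ j ∈ Icc 1 k, fB c d N w j / fA a b N w j

/-- The sum of fitness differences over `j = 1, …, k` (without the factor `w`). -/
noncomputable def sumG (a b c d : ℝ) (N k : ℕ) : ℝ :=
  (k : ℝ) * ((c - a - d + b) * ((k : ℝ) + 1) / 2 + (d - b) * N + a - d) / ((N : ℝ) - 1)

lemma rhoA_eq (a b c d : ℝ) (N : ℕ) (hN : 1 ≤ N) (w : ℝ) :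
    rhoA a b c d N w = (∑ k ∈ range N, prodR a b c d N w k)⁻¹ := by
  obtain ⟨n, rfl⟩ : ∃ n, N = n + 1 := ⟨N - 1, by omega⟩
  unfold rhoA
  rw [one_div, Finset.sum_range_succ', add_comm]
  congr 2
  · rw [Nat.add_sub_cancel]
    refine (Finset.sum_bij (fun k _ => k + 1) ?_ ?_ ?_ ?_).symm
    · intro k hk; simp at hk ⊢; omega
    · intro k _ l _ h; omega
    · intro k hk
      simp at hk
      exact ⟨k - 1, by simp; omega, by omega⟩
    · intro k _; rfl

lemma exp_le_one_add (x : ℝ) (hx : |x| ≤ 1 / 2) : Real.exp (x - x ^ 2) ≤ 1 + x := by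
  have h := abs_le.mp hx
  have h1 : 0 < 1 + x := by linarith
  have h4 : x - x ^ 2 = -(x ^ 2 - x) := by ring
  rw [h4, Real.exp_neg]
  rcases le_total 0 x with hx0 | hx0
  · have h3 := Real.add_one_le_exp (x ^ 2 - x)
    have h5 : 0 < x ^ 2 - x + 1 := by nlinarith [sq_nonneg (x - 1)]
    refine (inv_anti₀ h5 h3).trans ?_
    rw [inv_le_iff_one_le_mul₀ h5]
    have : 0 ≤ x ^ 3 := by positivity
    nlinarith
  · have h3 := Real.quadratic_le_exp_of_nonneg (x := x ^ 2 - x) (by nlinarith)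
    have h5 : 0 < 1 + (x ^ 2 - x) + (x ^ 2 - x) ^ 2 / 2 := by nlinarith [sq_nonneg (x ^ 2 - x)]
    refine (inv_anti₀ h5 h3).trans ?_
    rw [inv_le_iff_one_le_mul₀ h5]
    have e : (1 + x) * (1 + (x ^ 2 - x) + (x ^ 2 - x) ^ 2 / 2) =
      1 + x ^ 2 * (1 + x - x ^ 2 + x ^ 3) / 2 := by ring
    have h6 : 0 ≤ 1 + x - x ^ 2 + x ^ 3 := by nlinarith [sq_nonneg x]
    have := mul_nonneg (sq_nonneg x) h6
    linarith

lemma pay_bound (a b x y n : ℝ) (hn : 0 < n) (hx : 0 ≤ x) (hy : 0 ≤ y) (hxn : x ≤ n)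
    (hyn : y ≤ n) : |(a * x + b * y) / n| ≤ |a| + |b| := by
  rw [abs_div, abs_of_pos hn, div_le_iff₀ hn]
  calc |a * x + b * y| ≤ |a * x| + |b * y| := abs_add_le _ _
    _ = |a| * x + |b| * y := by rw [abs_mul, abs_mul, abs_of_nonneg hx, abs_of_nonneg hy]
    _ ≤ |a| * n + |b| * n := by gcongr
    _ = _ := by ring

lemma factor_bounds (a b c d M w : ℝ) (hM : M = |a| + |b| + |c| + |d| + 1) (hw : 0 < w)
    (hwM : w * M ≤ 1 / 2) (N j : ℕ) (hj : 1 ≤ j) (hjN : j + 1 ≤ N) :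
    0 < fA a b N w j ∧ 0 < fB c d N w j ∧
    fB c d N w j / fA a b N w j ≤
      Real.exp (w * (((c - a - d + b) * (j : ℝ) + (d - b) * N + a - d) / ((N : ℝ) - 1)) + (w * M) ^ 2) ∧
    Real.exp (w * (((c - a - d + b) * (j : ℝ) + (d - b) * N + a - d) / ((N : ℝ) - 1)) - (w * M) ^ 2) ≤
      fB c d N w j / fA a b N w j := by
  have hj' : (1 : ℝ) ≤ j := by exact_mod_cast hj
  have hN' : (j : ℝ) + 1 ≤ N := by exact_mod_cast hjN
  have hn : (0 : ℝ) < (N : ℝ) - 1 := by linarith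
  have hA := pay_bound a b (j - 1) (N - j) (N - 1) hn (by linarith) (by linarith) (by linarith)
    (by linarith)
  have hB := pay_bound c d j (N - j - 1) (N - 1) hn (by linarith) (by linarith) (by linarith)
    (by linarith)
  have ea : fA a b N w j = 1 + w * ((a * ((j : ℝ) - 1) + b * ((N : ℝ) - j)) / ((N : ℝ) - 1)) := by
    unfold fA; ring
  have eb : fB c d N w j = 1 + w * ((c * (j : ℝ) + d * ((N : ℝ) - j - 1)) / ((N : ℝ) - 1)) := by
    unfold fB; ring
  have eg : ((c - a - d + b) * (j : ℝ) + (d - b) * N + a - d) / ((N : ℝ) - 1) =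
      (c * (j : ℝ) + d * ((N : ℝ) - j - 1)) / ((N : ℝ) - 1) -
      (a * ((j : ℝ) - 1) + b * ((N : ℝ) - j)) / ((N : ℝ) - 1) := by
    rw [← sub_div]; congr 1; ring
  rw [ea, eb, eg]
  generalize (a * ((j : ℝ) - 1) + b * ((N : ℝ) - j)) / ((N : ℝ) - 1) = x at *
  generalize (c * (j : ℝ) + d * ((N : ℝ) - j - 1)) / ((N : ℝ) - 1) = y at *
  have pa := abs_nonneg a
  have pb := abs_nonneg b
  have pc := abs_nonneg c
  have pd := abs_nonneg d
  have hx : |w * x| ≤ w * M := by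
    rw [abs_mul, abs_of_pos hw]; gcongr; linarith
  have hy : |w * y| ≤ w * M := by
    rw [abs_mul, abs_of_pos hw]; gcongr; linarith
  have hx2 : (w * x) ^ 2 ≤ (w * M) ^ 2 := by
    rw [← sq_abs (w * x)]; gcongr
  have hy2 : (w * y) ^ 2 ≤ (w * M) ^ 2 := by
    rw [← sq_abs (w * y)]; gcongr
  have x1 := exp_le_one_add (w * x) (hx.trans hwM)
  have y1 := exp_le_one_add (w * y) (hy.trans hwM)
  have x2 := Real.add_one_le_exp (w * x)
  have y2 := Real.add_one_le_exp (w * y)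
  have px : 0 < 1 + w * x := (Real.exp_pos _).trans_le x1
  have py : 0 < 1 + w * y := (Real.exp_pos _).trans_le y1
  refine ⟨px, py, ?_, ?_⟩
  · rw [div_le_iff₀ px]
    calc 1 + w * y ≤ Real.exp (w * y) := by linarith
      _ ≤ Real.exp ((w * (y - x) + (w * M) ^ 2) + (w * x - (w * x) ^ 2)) :=
        Real.exp_le_exp.mpr (by nlinarith)
      _ = Real.exp (w * (y - x) + (w * M) ^ 2) * Real.exp (w * x - (w * x) ^ 2) := Real.exp_add _ _
      _ ≤ _ := by gcongr
  · rw [le_div_iff₀ px]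
    calc _ ≤ Real.exp (w * (y - x) - (w * M) ^ 2) * Real.exp (w * x) := by gcongr; linarith
      _ = Real.exp ((w * (y - x) - (w * M) ^ 2) + w * x) := (Real.exp_add _ _).symm
      _ ≤ Real.exp (w * y - (w * y) ^ 2) := Real.exp_le_exp.mpr (by nlinarith)
      _ ≤ _ := y1

lemma prod_bounds (a b c d M w : ℝ) (hM : M = |a| + |b| + |c| + |d| + 1) (hw : 0 < w)
    (hwM : w * M ≤ 1 / 2) (N k : ℕ) (hk : k + 1 ≤ N) :
    0 < prodR a b c d N w k ∧
    prodR a b c d N w k ≤ Real.exp (w * sumG a b c d N k + k * (w * M) ^ 2) ∧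
    Real.exp (w * sumG a b c d N k - k * (w * M) ^ 2) ≤ prodR a b c d N w k := by
  induction k with
  | zero => simp [prodR, sumG]
  | succ k ih =>
    obtain ⟨h0, h1, h2⟩ := ih (by omega)
    obtain ⟨fa, fb, f1, f2⟩ := factor_bounds a b c d M w hM hw hwM N (k + 1) (by omega) hk
    have e : prodR a b c d N w (k + 1) =
        prodR a b c d N w k * (fB c d N w (k + 1) / fA a b N w (k + 1)) := by
      unfold prodR; rw [Finset.prod_Icc_succ_top (by omega)]
    have eG : sumG a b c d N (k + 1) = sumG a b c d N k +
        ((c - a - d + b) * ((k + 1 : ℕ) : ℝ) + (d - b) * N + a - d) / ((N : ℝ) - 1) := by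
      unfold sumG
      rw [← add_div]; congr 1; push_cast; ring
    have hq := div_pos fb fa
    rw [e]
    refine ⟨mul_pos h0 hq, ?_, ?_⟩
    · calc _ ≤ _ := mul_le_mul h1 f1 hq.le (Real.exp_pos _).le
        _ = _ := by rw [← Real.exp_add, eG]; congr 1; push_cast; ring
    · calc _ = _ := ?_
        _ ≤ _ := mul_le_mul h2 f2 (Real.exp_pos _).le h0.le
      rw [← Real.exp_add, eG]; congr 1; push_cast; ring

lemma aff_tendsto (p q : ℝ) : Tendsto (fun N : ℕ => (p * (N : ℝ) + q) / ((N : ℝ) - 1)) atTop (𝓝 p) := by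
  have h : Tendsto (fun N : ℕ => p + (p + q) / ((N : ℝ) - 1)) atTop (𝓝 (p + 0)) := by
    refine tendsto_const_nhds.add (Tendsto.div_atTop tendsto_const_nhds ?_)
    exact tendsto_atTop_add_const_right _ _ tendsto_natCast_atTop_atTop
  rw [add_zero] at h
  refine h.congr' ?_
  filter_upwards [eventually_ge_atTop 2] with N hN
  have : (2 : ℝ) ≤ N := by exact_mod_cast hN
  have : (N : ℝ) - 1 ≠ 0 := by linarith
  field_simp
  ring

lemma prod_tendsto (a b c d w : ℝ) (h : 1 + w * b ≠ 0) (k : ℕ) :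
    Tendsto (fun N : ℕ => prodR a b c d N w k) atTop (𝓝 (((1 + w * d) / (1 + w * b)) ^ k)) := by
  have e : ((1 + w * d) / (1 + w * b)) ^ k = ∏ j ∈ Icc 1 k, ((1 + w * d) / (1 + w * b)) := by
    rw [Finset.prod_const]; simp
  rw [e]
  unfold prodR
  refine tendsto_finsetProd _ fun j _ => Tendsto.div ?_ ?_ h
  · refine (((aff_tendsto d (c * j - d * j - d)).const_mul w).const_add 1).congr fun N => ?_
    unfold fB; ring
  · refine (((aff_tendsto b (a * j - a - b * j)).const_mul w).const_add 1).congr fun N => ?_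
    unfold fA; ring

theorem rhoA_Nw_asymptotics (a b c d : ℝ) :
    ((b ≤ d ∨ (b > d ∧ a + b < c + d)) →
      ∃ w' > (0 : ℝ), ∃ L : ℝ → ℝ,
        (∀ w : ℝ, 0 < w → w < w' →
          Tendsto (fun N : ℕ => rhoA a b c d N w) atTop (𝓝 (L w))) ∧
        Tendsto (fun w : ℝ => L w / w) (𝓝[>] 0) (𝓝 0)) ∧
    ((b > d ∧ a + b > c + d) →
      ∃ w' > (0 : ℝ), ∃ L : ℝ → ℝ,
        (∀ w : ℝ, 0 < w → w < w' →
          Tendsto (fun N : ℕ => rhoA a b c d N w) atTop (𝓝 (L w))) ∧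
        Tendsto (fun w : ℝ => L w / w) (𝓝[>] 0) (𝓝 (b - d))) := by
  obtain ⟨M, hM⟩ : ∃ M, M = |a| + |b| + |c| + |d| + 1 := ⟨_, rfl⟩
  have pa := abs_nonneg a
  have pb := abs_nonneg b
  have pc := abs_nonneg c
  have pd := abs_nonneg d
  have hM0 : 0 < M := by linarith
  have hMw : ∀ w, w < 1 / (2 * M) → w * M ≤ 1 / 2 := fun w h => by
    rw [lt_div_iff₀ (by positivity)] at h; linarith
  have hb1 : ∀ w, 0 < w → w * M ≤ 1 / 2 → 0 < 1 + w * b := fun w hw h => by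
    have : -M ≤ b := by have := neg_abs_le b; linarith
    nlinarith
  have hsumpos : ∀ w, 0 < w → w * M ≤ 1 / 2 → ∀ K N : ℕ, K ≤ N →
      ∑ k ∈ range K, prodR a b c d N w k ≤ ∑ k ∈ range N, prodR a b c d N w k :=
    fun w hw h K N hKN => Finset.sum_le_sum_of_subset_of_nonneg (by simpa using hKN)
      fun k hk _ => (prod_bounds a b c d M w hM hw h N k (by simpa using hk)).1.le
  -- a criterion for the limit zero
  have hzero : ∀ w, Tendsto (fun N : ℕ => ∑ k ∈ range N, prodR a b c d N w k) atTop atTop →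
      Tendsto (fun N : ℕ => rhoA a b c d N w) atTop (𝓝 0) := fun w h => by
    refine (tendsto_inv_atTop_zero.comp h).congr' ?_
    filter_upwards [eventually_ge_atTop 1] with N hN
    rw [rhoA_eq a b c d N hN w]; rfl
  refine ⟨?_, ?_⟩
  · rintro (hbd | ⟨hbd, hac⟩)
    · refine ⟨1 / (2 * M), by positivity, fun _ => 0, fun w hw hw' => hzero w ?_, by simp⟩
      have hwM := hMw w hw'
      have hbp := hb1 w hw hwM
      rw [tendsto_atTop]
      intro B
      obtain ⟨K, hK⟩ := exists_nat_gt B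
      have hq : 1 ≤ (1 + w * d) / (1 + w * b) := by
        rw [le_div_iff₀ hbp]; nlinarith
      have ht : Tendsto (fun N : ℕ => ∑ k ∈ range K, prodR a b c d N w k) atTop
          (𝓝 (∑ k ∈ range K, ((1 + w * d) / (1 + w * b)) ^ k)) :=
        tendsto_finsetSum _ fun k _ => prod_tendsto a b c d w hbp.ne' k
      have hlt : B < ∑ k ∈ range K, ((1 + w * d) / (1 + w * b)) ^ k := by
        refine hK.trans_le ?_
        calc (K : ℝ) = ∑ k ∈ range K, (1 : ℝ) := by simp
          _ ≤ _ := Finset.sum_le_sum fun k _ => one_le_pow₀ hq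
      filter_upwards [ht.eventually_const_lt hlt, eventually_ge_atTop K] with N h1 h2
      exact h1.le.trans (hsumpos w hw hwM K N h2)
    · have hδ : 0 < (c + d - a - b) / 2 := by linarith
      set δ := (c + d - a - b) / 2 with hδe
      refine ⟨min (1 / (2 * M)) (δ / (2 * M ^ 2)), by positivity, fun _ => 0,
        fun w hw hw' => hzero w ?_, by simp⟩
      have hwM := hMw w (hw'.trans_le (min_le_left _ _))
      have hwδ : w * M ^ 2 ≤ δ / 2 := by
        have := hw'.trans_le (min_le_right _ _)
        rw [lt_div_iff₀ (by positivity)] at this; linarith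
      have hlin : Tendsto (fun N : ℕ => (w * δ / 2) * (N : ℝ) + (w * (a - d))) atTop atTop :=
        tendsto_atTop_add_const_right _ _
          (tendsto_natCast_atTop_atTop.const_mul_atTop (by positivity))
      refine tendsto_atTop_mono' _ ?_ (Real.tendsto_exp_atTop.comp hlin)
      filter_upwards [eventually_ge_atTop 2] with N hN
      obtain ⟨n, rfl⟩ : ∃ n, N = n + 1 := ⟨N - 1, by omega⟩
      have hn : (1 : ℝ) ≤ n := by exact_mod_cast (by omega : 1 ≤ n)
      have h1 := (prod_bounds a b c d M w hM hw hwM (n + 1) n le_rfl).2.2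
      have h2 : prodR a b c d (n + 1) w n ≤ ∑ k ∈ range (n + 1), prodR a b c d (n + 1) w k := by
        refine Finset.single_le_sum (f := fun k => prodR a b c d (n + 1) w k)
          (fun k hk => (prod_bounds a b c d M w hM hw hwM (n + 1) k (by simpa using hk)).1.le)
          (by simp)
      refine le_trans ?_ (h1.trans h2)
      refine Real.exp_le_exp.mpr ?_
      have e : sumG a b c d (n + 1) n = δ * (n + 1) + a - d := by
        have hn0 : (n : ℝ) ≠ 0 := by linarith
        unfold sumG; push_cast; rw [hδe, add_sub_cancel_right, 
          mul_div_cancel_left₀ _ hn0]; ring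
      rw [e]
      push_cast
      have h3 : (n : ℝ) * (w * M) ^ 2 ≤ n * (w * (δ / 2)) := by
        have : (w * M) ^ 2 = w * (w * M ^ 2) := by ring
        rw [this]; gcongr
      nlinarith [mul_pos hw hδ]
  · rintro ⟨hbd, hac⟩
    obtain ⟨δ, hδ, hδ1, hδ2⟩ : ∃ δ, 0 < δ ∧ δ < b - d ∧ δ < (a + b - c - d) / 2 := by
      have : 0 < min (b - d) ((a + b - c - d) / 2) := lt_min (by linarith) (by linarith)
      obtain ⟨δ, h1, h2⟩ := exists_between this
      exact ⟨δ, h1, h2.trans_le (min_le_left _ _), h2.trans_le (min_le_right _ _)⟩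
    refine ⟨min (1 / (2 * M)) (δ / (2 * M ^ 2)), by positivity, fun w => w * (b - d) / (1 + w * b),
        fun w hw hw' => ?_, ?_⟩
    · have hwM := hMw w (hw'.trans_le (min_le_left _ _))
      have hwδ : w * M ^ 2 ≤ δ / 2 := by
        have := hw'.trans_le (min_le_right _ _)
        rw [lt_div_iff₀ (by positivity)] at this; linarith
      have hbp := hb1 w hw hwM
      have hdp : 0 < 1 + w * d := by
        have : -M ≤ d := by have := neg_abs_le d; linarith
        nlinarith
      set q := (1 + w * d) / (1 + w * b) with hq
      have hq0 : 0 ≤ q := by positivity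
      have hq1 : q < 1 := by rw [hq, div_lt_one hbp]; nlinarith
      have hqs : (1 - q)⁻¹ ≠ 0 := inv_ne_zero (by linarith)
      have hL : w * (b - d) / (1 + w * b) = ((1 - q)⁻¹)⁻¹ := by
        rw [inv_inv, hq]; field_simp; ring
      simp only [hL]
      have e1 := (aff_tendsto (d - b) ((c - a - d + b) / 2 + a - d)).eventually_le_const
        (u := -δ) (by linarith)
      have e2 := (aff_tendsto ((c - a - d + b) / 2 + (d - b)) (a - d)).eventually_le_const
        (u := -δ) (by linarith)
      have key : Tendsto (fun N : ℕ => ∑' k, if k < N then prodR a b c d N w k else 0) atTop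
          (𝓝 (∑' k, q ^ k)) := by
        refine tendsto_tsum_of_dominated_convergence (bound := fun k => Real.exp (-(w * δ / 2)) ^ k)
          (summable_geometric_of_lt_one (Real.exp_pos _).le
            (Real.exp_lt_one_iff.mpr (by nlinarith [mul_pos hw hδ]))) ?_ ?_
        · intro k
          refine (prod_tendsto a b c d w hbp.ne' k).congr' ?_
          filter_upwards [eventually_gt_atTop k] with N hN
          rw [if_pos hN]
        · filter_upwards [e1, e2, eventually_ge_atTop 2] with N h1 h2 hN k
          split_ifs with hk
          · obtain ⟨p0, p1, -⟩ := prod_bounds a b c d M w hM hw hwM N k hk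
            rw [Real.norm_of_nonneg p0.le]
            refine p1.trans ?_
            rw [← Real.exp_nat_mul]
            refine Real.exp_le_exp.mpr ?_
            have hN' : (2 : ℝ) ≤ N := by exact_mod_cast hN
            have hn : (0 : ℝ) < (N : ℝ) - 1 := by linarith
            have hk' : (k : ℝ) + 1 ≤ N := by exact_mod_cast hk
            have hk0 : (0 : ℝ) ≤ k := by positivity
            have hG : sumG a b c d N k ≤ k * (-δ) := by
              unfold sumG
              rw [mul_div_assoc]
              refine mul_le_mul_of_nonneg_left ?_ hk0
              rw [div_le_iff₀ hn] at h1 h2 ⊢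
              rcases le_total 0 (c - a - d + b) with hα | hα
              · nlinarith
              · nlinarith
            have h3 : (k : ℝ) * (w * M) ^ 2 ≤ k * (w * (δ / 2)) := by
              have : (w * M) ^ 2 = w * (w * M ^ 2) := by ring
              rw [this]; gcongr
            have h4 := mul_le_mul_of_nonneg_left hG hw.le
            linarith
          · rw [norm_zero]; positivity
      rw [tsum_geometric_of_lt_one hq0 hq1] at key
      refine (key.inv₀ hqs).congr' ?_
      filter_upwards [eventually_ge_atTop 1] with N hN
      rw [rhoA_eq a b c d N hN w, tsum_eq_sum (s := range N)]
      · congr 1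
        exact Finset.sum_congr rfl fun k hk => if_pos (by simpa using hk)
      · intro k hk
        exact if_neg (by simpa using hk)
    · have h1 : Tendsto (fun w : ℝ => (b - d) / (1 + w * b)) (𝓝 0) (𝓝 ((b - d) / (1 + 0 * b))) := by
        refine ContinuousAt.tendsto (f := fun w : ℝ => (b - d) / (1 + w * b)) ?_
        exact ContinuousAt.div (by fun_prop) (by fun_prop) (by simp)
      simp only [zero_mul, add_zero, div_one] at h1
      refine (h1.mono_left nhdsWithin_le_nhds).congr' ?_
      filter_upwards [self_mem_nhdsWithin] with w hw
      have : w ≠ 0 := ne_of_gt hw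
      rw [mul_div_assoc, mul_div_cancel_left₀ _ this]
end

section
/- Let a, b, c, d be real numbers satisfying one of the following: (i) b > d and a + b > c + d; (ii) b = d and a > c; (iii) b = d, a = c and b > c. Then ρ_A(N,w) > 1/N holds in the Nw limit; that is, there exists w* > 0 such that for every w with 0 < w < w* there exists N* such that ρ_A(N,w) > 1/N for all integers N ≥ N*. -/
open Filter Finset Topology

lemma prod_exp_bound (r : ℕ → ℝ) (p q : ℝ) (k : ℕ)
    (h : ∀ j ∈ Icc 1 k, 0 < r j ∧ r j ≤ Real.exp (p + q * j)) :
    0 < ∏ j ∈ Icc 1 k, r j ∧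
    ∏ j ∈ Icc 1 k, r j ≤ Real.exp (p * k + q * (k * (k + 1) / 2)) := by
  induction k with
  | zero => simp
  | succ k ih =>
    have ih' := ih (fun j hj => h j (by simp only [mem_Icc] at hj ⊢; omega))
    have hk := h (k + 1) (by simp)
    rw [Finset.prod_Icc_succ_top (by omega)]
    refine ⟨mul_pos ih'.1 hk.1, ?_⟩
    calc _ ≤ Real.exp (p * k + q * (k * (k + 1) / 2)) * Real.exp (p + q * ((k + 1 : ℕ) : ℝ)) :=
          mul_le_mul ih'.2 hk.2 hk.1.le (Real.exp_pos _).le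
      _ = _ := by
          rw [← Real.exp_add]; congr 1; push_cast; ring

lemma rho_of_sum (a b c d w : ℝ) (N : ℕ) (hN : 2 ≤ N)
    (hpos : ∀ k ∈ Icc 1 (N - 1), 0 < ∏ j ∈ Icc 1 k, fB c d N w j / fA a b N w j)
    (hs : ∑ k ∈ Icc 1 (N - 1), ((∏ j ∈ Icc 1 k, fB c d N w j / fA a b N w j) - 1) < 0) :
    rhoA a b c d N w > 1 / (N : ℝ) := by
  unfold rhoA
  have h0 := Finset.sum_nonneg (fun k hk => (hpos k hk).le)
  rw [Finset.sum_sub_distrib] at hs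
  simp only [sum_const, Nat.card_Icc, nsmul_eq_mul, mul_one, Nat.add_sub_cancel] at hs
  rw [Nat.cast_sub (by omega)] at hs
  push_cast at hs
  apply one_div_lt_one_div_of_lt <;> linarith

lemma conv_bound (x y n u v : ℝ) (hn : 0 < n) (hu : 0 ≤ u) (hu' : u ≤ n) (hv : 0 ≤ v)
    (hv' : v ≤ n) : |(x * u + y * v) / n| ≤ |x| + |y| := by
  rw [abs_div, abs_of_pos hn, div_le_iff₀ hn]
  calc _ ≤ |x * u| + |y * v| := abs_add_le _ _
    _ = |x| * u + |y| * v := by rw [abs_mul, abs_mul, abs_of_nonneg hu, abs_of_nonneg hv]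
    _ ≤ _ := by nlinarith [abs_nonneg x, abs_nonneg y]

lemma f_bounds (a b c d w M : ℝ) (hM : M = |a| + |b| + |c| + |d| + 1) (hw : 0 < w)
    (N j : ℕ) (hN : 2 ≤ N) (hj1 : 1 ≤ j) (hj2 : j ≤ N - 1) :
    |fA a b N w j - 1| ≤ w * M ∧ |fB c d N w j - 1| ≤ w * M := by
  have hN' : (2 : ℝ) ≤ N := by exact_mod_cast hN
  have h1 : (1 : ℝ) ≤ j := by exact_mod_cast hj1
  have h2 : (j : ℝ) + 1 ≤ N := by exact_mod_cast (by omega : j + 1 ≤ N)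
  have A := conv_bound a b ((N : ℝ) - 1) ((j : ℝ) - 1) ((N : ℝ) - j) (by linarith) (by linarith)
    (by linarith) (by linarith) (by linarith)
  have B := conv_bound c d ((N : ℝ) - 1) (j : ℝ) ((N : ℝ) - j - 1) (by linarith) (by linarith)
    (by linarith) (by linarith) (by linarith)
  have := abs_nonneg a
  have := abs_nonneg b
  have := abs_nonneg c
  have := abs_nonneg d
  unfold fA fB
  rw [add_sub_cancel_left, add_sub_cancel_left, mul_div_assoc, mul_div_assoc, abs_mul, abs_mul,
    abs_of_pos hw]
  constructor <;> apply mul_le_mul_of_nonneg_left _ hw.le <;> linarith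

lemma ratio_exp (x y : ℝ) (hx : 0 < x) : y / x ≤ Real.exp ((y - x) / x) := by
  have := Real.add_one_le_exp ((y - x) / x)
  have e : (y - x) / x + 1 = y / x := by field_simp; ring
  linarith

lemma f_diff (a b c d w : ℝ) (N j : ℕ) :
    fB c d N w j - fA a b N w j =
      w / ((N : ℝ) - 1) * ((a - d) - (a - c) * j - (b - d) * (N - j)) := by
  unfold fA fB
  ring

lemma all_lt (a b c d w : ℝ) (N : ℕ) (hN : 2 ≤ N)
    (hpos : ∀ k ∈ Icc 1 (N - 1), 0 < ∏ j ∈ Icc 1 k, fB c d N w j / fA a b N w j)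
    (hs : ∀ k ∈ Icc 1 (N - 1), (∏ j ∈ Icc 1 k, fB c d N w j / fA a b N w j) < 1) :
    rhoA a b c d N w > 1 / (N : ℝ) := by
  apply rho_of_sum _ _ _ _ _ _ hN hpos
  apply Finset.sum_neg
  · intro k hk
    linarith [hs k hk]
  · exact ⟨1, by simp only [mem_Icc]; omega⟩

lemma case_i (a b c d : ℝ) (h1 : b > d) (h2 : a + b > c + d) :
    ∃ w' > (0 : ℝ), ∀ w : ℝ, 0 < w → w < w' → ∃ N₀ : ℕ, ∀ N : ℕ, N₀ ≤ N →
      rhoA a b c d N w > 1 / (N : ℝ) := by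
  obtain ⟨M, hM⟩ : ∃ M, M = |a| + |b| + |c| + |d| + 1 := ⟨_, rfl⟩
  have hM1 : 1 ≤ M := by rw [hM]; linarith [abs_nonneg a, abs_nonneg b, abs_nonneg c, abs_nonneg d]
  obtain ⟨m, hm, hm1, hm2⟩ : ∃ m : ℝ, 0 < m ∧ m ≤ b - d ∧ m ≤ (a + b - c - d) / 2 :=
    ⟨min (b - d) ((a + b - c - d) / 2), lt_min (by linarith) (by linarith), min_le_left _ _,
      min_le_right _ _⟩
  refine ⟨min (1 / (2 * M)) (m / (8 * M ^ 2)), by positivity, fun w hw hw' => ?_⟩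
  have hw1 : w * M < 1 / 2 := by
    have := lt_of_lt_of_le hw' (min_le_left _ _)
    rw [lt_div_iff₀ (by positivity)] at this; linarith
  have hw2 : 4 * w * M ^ 2 < m / 2 := by
    have := lt_of_lt_of_le hw' (min_le_right _ _)
    rw [lt_div_iff₀ (by positivity)] at this; linarith
  obtain ⟨N₁, hN₁⟩ := exists_nat_gt (|a - d| / (m / 2))
  refine ⟨N₁ + 2, fun N hN => ?_⟩
  have hN2 : 2 ≤ N := by omega
  have hN' : (2 : ℝ) ≤ N := by exact_mod_cast hN2
  have hNbig : |a - d| < N * (m / 2) := by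
    rw [div_lt_iff₀ (by positivity)] at hN₁
    have : (N₁ : ℝ) ≤ N := by exact_mod_cast (by omega : N₁ ≤ N)
    nlinarith
  have key : ∀ k ∈ Icc 1 (N - 1), 0 < ∏ j ∈ Icc 1 k, fB c d N w j / fA a b N w j ∧
      ∏ j ∈ Icc 1 k, fB c d N w j / fA a b N w j < 1 := by
    intro k hk
    rw [mem_Icc] at hk
    have hb := prod_exp_bound (fun j => fB c d N w j / fA a b N w j)
      (w / ((N : ℝ) - 1) * ((a - d) - (b - d) * N) + 4 * w ^ 2 * M ^ 2)
      (w / ((N : ℝ) - 1) * ((b - d) - (a - c))) k ?_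
    · refine ⟨hb.1, lt_of_le_of_lt hb.2 ?_⟩
      rw [Real.exp_lt_one_iff]
      have hk1 : (1 : ℝ) ≤ k := by exact_mod_cast hk.1
      have hk2 : (k : ℝ) + 1 ≤ N := by exact_mod_cast (by omega : k + 1 ≤ N)
      have hn : (0 : ℝ) < N - 1 := by linarith
      have e : (w / ((N : ℝ) - 1) * ((a - d) - (b - d) * N) + 4 * w ^ 2 * M ^ 2) * k +
          (w / ((N : ℝ) - 1) * ((b - d) - (a - c))) * (k * (k + 1) / 2) =
          (w * k / (N - 1)) * ((a - d) - (b - d) * (N - (k + 1))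
            - (k + 1) * ((a + b - c - d) / 2) + 4 * w * M ^ 2 * (N - 1)) := by
        field_simp; ring
      rw [e]
      apply mul_neg_of_pos_of_neg (by positivity)
      have := le_abs_self (a - d)
      have i1 : m * (N - (k + 1)) ≤ (b - d) * (N - (k + 1)) :=
        mul_le_mul_of_nonneg_right hm1 (by linarith)
      have i2 : (k + 1) * m ≤ (k + 1) * ((a + b - c - d) / 2) :=
        mul_le_mul_of_nonneg_left hm2 (by linarith)
      have i3 : 4 * w * M ^ 2 * (N - 1) ≤ m / 2 * (N - 1) :=
        mul_le_mul_of_nonneg_right hw2.le hn.le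
      linarith
    · intro j hj
      rw [mem_Icc] at hj
      obtain ⟨hA, hB⟩ := f_bounds a b c d w M hM hw N j hN2 hj.1 (by omega)
      have hd := f_diff a b c d w N j
      rw [abs_le] at hA hB
      have pA : 1 / 2 < fA a b N w j := by linarith
      have pB : 1 / 2 < fB c d N w j := by linarith
      refine ⟨by apply div_pos <;> linarith, (ratio_exp _ _ (by linarith)).trans ?_⟩
      rw [Real.exp_le_exp]
      have e : w / ((N : ℝ) - 1) * ((a - d) - (b - d) * N) + 4 * w ^ 2 * M ^ 2 +
          (w / ((N : ℝ) - 1) * ((b - d) - (a - c))) * j =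
          (fB c d N w j - fA a b N w j) + 4 * w ^ 2 * M ^ 2 := by rw [hd]; ring
      rw [e]
      generalize fA a b N w j = x at *
      generalize fB c d N w j = y at *
      rw [div_le_iff₀ (by linarith)]
      have hq : |(y - x) * (x - 1)| ≤ (2 * (w * M)) * (w * M) := by
        rw [abs_mul]
        apply mul_le_mul _ _ (abs_nonneg _) (by positivity)
        · rw [abs_le]; constructor <;> linarith
        · rw [abs_le]; constructor <;> linarith
      rw [abs_le] at hq
      have : 4 * w ^ 2 * M ^ 2 * (1 / 2) ≤ 4 * w ^ 2 * M ^ 2 * x :=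
        mul_le_mul_of_nonneg_left pA.le (by positivity)
      nlinarith
  exact all_lt _ _ _ _ _ _ hN2 (fun k hk => (key k hk).1) (fun k hk => (key k hk).2)

lemma case_iii (a b c d : ℝ) (h1 : b = d) (h2 : a = c) (h3 : b > c) :
    ∃ w' > (0 : ℝ), ∀ w : ℝ, 0 < w → w < w' → ∃ N₀ : ℕ, ∀ N : ℕ, N₀ ≤ N →
      rhoA a b c d N w > 1 / (N : ℝ) := by
  obtain ⟨M, hM⟩ : ∃ M, M = |a| + |b| + |c| + |d| + 1 := ⟨_, rfl⟩
  have hM1 : 1 ≤ M := by rw [hM]; linarith [abs_nonneg a, abs_nonneg b, abs_nonneg c, abs_nonneg d]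
  refine ⟨1 / (2 * M), by positivity, fun w hw hw' => ⟨2, fun N hN2 => ?_⟩⟩
  have hw1 : w * M < 1 / 2 := by
    rw [lt_div_iff₀ (by positivity)] at hw'; linarith
  have hN' : (2 : ℝ) ≤ N := by exact_mod_cast hN2
  have key : ∀ j, 1 ≤ j → j ≤ N - 1 →
      0 < fB c d N w j / fA a b N w j ∧ fB c d N w j / fA a b N w j < 1 := by
    intro j hj1 hj2
    obtain ⟨hA, hB⟩ := f_bounds a b c d w M hM hw N j hN2 hj1 hj2
    have hd := f_diff a b c d w N j
    rw [abs_le] at hA hB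
    have hn : (0 : ℝ) < w / (N - 1) := div_pos hw (by linarith)
    refine ⟨by apply div_pos <;> linarith, ?_⟩
    rw [div_lt_one (by linarith)]
    have : w / ((N : ℝ) - 1) * ((a - d) - (a - c) * j - (b - d) * (N - j)) < 0 := by
      apply mul_neg_of_pos_of_neg hn
      rw [h1, h2]
      linarith
    linarith
  apply all_lt _ _ _ _ _ _ hN2
  · intro k hk
    rw [mem_Icc] at hk
    apply Finset.prod_pos
    intro j hj
    rw [mem_Icc] at hj
    exact (key j hj.1 (by omega)).1
  · intro k hk
    rw [mem_Icc] at hk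
    calc _ < ∏ j ∈ Icc 1 k, (1 : ℝ) := by
          apply Finset.prod_lt_prod_of_nonempty
          · intro j hj
            rw [mem_Icc] at hj
            exact (key j hj.1 (by omega)).1
          · intro j hj
            rw [mem_Icc] at hj
            exact (key j hj.1 (by omega)).2
          · exact ⟨1, by simp only [mem_Icc]; omega⟩
      _ = 1 := by simp

lemma case_ii (a b c d : ℝ) (h1 : b = d) (h2 : a > c) :
    ∃ w' > (0 : ℝ), ∀ w : ℝ, 0 < w → w < w' → ∃ N₀ : ℕ, ∀ N : ℕ, N₀ ≤ N →
      rhoA a b c d N w > 1 / (N : ℝ) := by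
  obtain ⟨M, hM⟩ : ∃ M, M = |a| + |b| + |c| + |d| + 1 := ⟨_, rfl⟩
  have hM1 : 1 ≤ M := by rw [hM]; linarith [abs_nonneg a, abs_nonneg b, abs_nonneg c, abs_nonneg d]
  refine ⟨1 / (2 * M), by positivity, fun w hw hw' => ?_⟩
  have hw1 : w * M < 1 / 2 := by
    rw [lt_div_iff₀ (by positivity)] at hw'; linarith
  obtain ⟨E, hE0, hE⟩ : ∃ E : ℝ, 0 ≤ E ∧ a - d ≤ E := ⟨|a - d|, abs_nonneg _, le_abs_self _⟩
  obtain ⟨δ, hδ⟩ : ∃ δ, δ = a - c := ⟨_, rfl⟩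
  have hδ0 : 0 < δ := by linarith
  obtain ⟨K, hK⟩ := exists_nat_gt (8 * E / δ)
  rw [div_lt_iff₀ hδ0] at hK
  -- small terms
  have hlim1 : Tendsto (fun N : ℕ => (K : ℝ) *
      (Real.exp (w * (2 * E * K) / ((N : ℝ) - 1)) - 1)) atTop (𝓝 0) := by
    have t1 : Tendsto (fun N : ℕ => (N : ℝ) - 1) atTop atTop :=
      tendsto_atTop_add_const_right _ _ tendsto_natCast_atTop_atTop
    have t2 := t1.const_div_atTop (w * (2 * E * K))
    have t3 := (Real.continuous_exp.tendsto 0).comp t2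
    have t4 := (t3.sub_const 1).const_mul (K : ℝ)
    simpa using t4
  have hlim2 : Tendsto (fun N : ℕ => Real.exp (w * (2 * E - δ * N / 4))) atTop (𝓝 0) := by
    apply Real.tendsto_exp_atBot.comp
    apply Tendsto.const_mul_atBot hw
    have t1 : Tendsto (fun N : ℕ => (δ / 4) * (N : ℝ)) atTop atTop :=
      tendsto_natCast_atTop_atTop.const_mul_atTop (by positivity)
    have t2 := tendsto_atBot_add_const_left atTop (2 * E) (tendsto_neg_atTop_atBot.comp t1)
    refine t2.congr (fun N => ?_)
    simp only [Function.comp]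
    ring
  have ev := (hlim1.eventually (gt_mem_nhds (by norm_num : (0 : ℝ) < 1 / 2))).and
    ((hlim2.eventually (gt_mem_nhds (by norm_num : (0 : ℝ) < 1 / 2))).and
      (eventually_ge_atTop 2))
  obtain ⟨N₀, hN₀⟩ := eventually_atTop.1 ev
  refine ⟨N₀, fun N hN => ?_⟩
  obtain ⟨l1, l2, hN2⟩ := hN₀ N hN
  have hN' : (2 : ℝ) ≤ N := by exact_mod_cast hN2
  have hn : (0 : ℝ) < N - 1 := by linarith
  have key : ∀ k ∈ Icc 1 (N - 1), 0 < ∏ j ∈ Icc 1 k, fB c d N w j / fA a b N w j ∧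
      ∏ j ∈ Icc 1 k, fB c d N w j / fA a b N w j ≤
        Real.exp (w * k / (N - 1) * (2 * E - δ * (k + 1) / 4)) := by
    intro k hk
    rw [mem_Icc] at hk
    have hb := prod_exp_bound (fun j => fB c d N w j / fA a b N w j)
      (w / ((N : ℝ) - 1) * (2 * E)) (w / ((N : ℝ) - 1) * (- δ / 2)) k ?_
    · refine ⟨hb.1, hb.2.trans (le_of_eq ?_)⟩
      congr 1
      field_simp
      ring
    · intro j hj
      rw [mem_Icc] at hj
      obtain ⟨hA, hB⟩ := f_bounds a b c d w M hM hw N j hN2 hj.1 (by omega)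
      have hd := f_diff a b c d w N j
      rw [abs_le] at hA hB
      have pA : 1 / 2 < fA a b N w j := by linarith
      have pB : 1 / 2 < fB c d N w j := by linarith
      have pA' : fA a b N w j < 2 := by linarith
      refine ⟨by apply div_pos <;> linarith, (ratio_exp _ _ (by linarith)).trans ?_⟩
      rw [Real.exp_le_exp, hd, div_le_iff₀ (by linarith)]
      have hw0 : 0 < w / ((N : ℝ) - 1) := by positivity
      generalize fA a b N w j = x at *
      have hj0 : (0 : ℝ) ≤ δ * j := by positivity
      have e : (w / ((N : ℝ) - 1) * (2 * E) + w / ((N : ℝ) - 1) * (- δ / 2) * j) * x =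
        w / ((N : ℝ) - 1) * ((2 * E - δ * j / 2) * x) := by ring
      rw [e, h1, ← hδ]
      apply mul_le_mul_of_nonneg_left _ hw0.le
      nlinarith
  apply rho_of_sum _ _ _ _ _ _ hN2 (fun k hk => (key k hk).1)
  have hs : Icc 1 (N - 1) = insert (N - 1) (Icc 1 (N - 2)) := by
    ext x; simp only [mem_Icc, mem_insert]; omega
  rw [hs, Finset.sum_insert (by simp only [mem_Icc]; omega)]
  have last := (key (N - 1) (by simp only [mem_Icc]; omega)).2
  have elast : w * ((N - 1 : ℕ) : ℝ) / (N - 1) * (2 * E - δ * (((N - 1 : ℕ) : ℝ) + 1) / 4) =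
      w * (2 * E - δ * N / 4) := by
    rw [Nat.cast_sub (by omega)]
    push_cast
    field_simp
    ring
  rw [elast] at last
  obtain ⟨η, hη⟩ : ∃ η, η = Real.exp (w * (2 * E * K) / ((N : ℝ) - 1)) - 1 := ⟨_, rfl⟩
  have hη0 : 0 ≤ η := by
    rw [hη, sub_nonneg, Real.one_le_exp_iff]; positivity
  have rest : ∑ k ∈ Icc 1 (N - 2), ((∏ j ∈ Icc 1 k, fB c d N w j / fA a b N w j) - 1) ≤
      K * η := by
    calc _ ≤ ∑ k ∈ Icc 1 (N - 2), (if k < K then η else 0) := by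
          apply Finset.sum_le_sum
          intro k hk
          rw [mem_Icc] at hk
          have hb := (key k (by simp only [mem_Icc]; omega)).2
          split_ifs with hkK
          · rw [hη]
            refine sub_le_sub_right (hb.trans ?_) 1
            rw [Real.exp_le_exp]
            have e : w * (k : ℝ) / (N - 1) * (2 * E - δ * (k + 1) / 4) =
              w * (k * (2 * E - δ * (k + 1) / 4)) / (N - 1) := by ring
            rw [e]
            apply div_le_div_of_nonneg_right _ hn.le
            apply mul_le_mul_of_nonneg_left _ hw.le
            have hkK' : (k : ℝ) ≤ K := by exact_mod_cast hkK.le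
            have : 0 ≤ (k : ℝ) * (δ * (k + 1) / 4) := by positivity
            nlinarith
          · have hle : Real.exp (w * k / (N - 1) * (2 * E - δ * (k + 1) / 4)) ≤ 1 := by
              rw [Real.exp_le_one_iff]
              apply mul_nonpos_of_nonneg_of_nonpos (by positivity)
              have hkK' : (K : ℝ) ≤ k := by exact_mod_cast (not_lt.1 hkK)
              nlinarith
            linarith
      _ = ∑ k ∈ (Icc 1 (N - 2)).filter (· < K), η := by rw [Finset.sum_filter]
      _ ≤ ∑ k ∈ range K, η := by
          apply Finset.sum_le_sum_of_subset_of_nonneg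
          · intro k hk
            simp only [mem_filter] at hk
            simpa using hk.2
          · intros; exact hη0
      _ = K * η := by simp
  rw [← hη] at l1
  linarith

/-- If (b > d and a + b > c + d), or (b = d and a > c), or (b = d, a = c and b > c),
then ρ_A > 1/N in the Nw limit. -/
theorem rhoA_gt_neutral_Nw (a b c d : ℝ)
    (h : (b > d ∧ a + b > c + d) ∨ (b = d ∧ a > c) ∨ (b = d ∧ a = c ∧ b > c)) :
    ∃ w' > (0 : ℝ), ∀ w : ℝ, 0 < w → w < w' → ∃ N₀ : ℕ, ∀ N : ℕ, N₀ ≤ N →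
      rhoA a b c d N w > 1 / (N : ℝ) := by
  rcases h with ⟨h1, h2⟩ | ⟨h1, h2⟩ | ⟨h1, h2, h3⟩
  · exact case_i a b c d h1 h2
  · exact case_ii a b c d h1 h2
  · exact case_iii a b c d h1 h2 h3
end

section
/- Let a, b, c, d be real numbers. If a + b > c + d, then ρ_A(N,w) > ρ_B(N,w) holds in the Nw limit; that is, there exists w* > 0 such that for every w with 0 < w < w* there exists N* such that ρ_A(N,w) > ρ_B(N,w) for all integers N ≥ N*. Conversely, if a + b < c + d, then ρ_A(N,w) < ρ_B(N,w) holds in the Nw limit. -/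
open Filter Finset Topology

lemma aux_log (x : ℝ) (hx : -(1/2) ≤ x) : Real.exp (x - 2 * x ^ 2) ≤ 1 + x := by
  have h0 : 0 < 1 + x := by linarith
  rw [← Real.le_log_iff_exp_le h0]
  refine le_trans ?_ (Real.one_sub_inv_le_log_of_pos h0)
  have h1 : (1 + x)⁻¹ = 1 - x + x ^ 2 * (1 + x)⁻¹ := by field_simp; ring
  have h2 : (1 + x)⁻¹ ≤ 2 := by
    rw [inv_le_comm₀ h0 (by norm_num)]; linarith
  have h3 := mul_le_mul_of_nonneg_left h2 (sq_nonneg x)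
  rw [h1]; linarith

lemma aux_prod (n : ℕ) (x y : ℕ → ℝ) (e : ℝ) (he : e ≤ 1 / 2)
    (hx : ∀ j ∈ Icc 1 n, |x j| ≤ e) (hy : ∀ j ∈ Icc 1 n, |y j| ≤ e)
    (h : ∑ j ∈ Icc 1 n, y j + n * (2 * e ^ 2) < ∑ j ∈ Icc 1 n, x j) :
    ∏ j ∈ Icc 1 n, (1 + y j) < ∏ j ∈ Icc 1 n, (1 + x j) := by
  have h1 : ∏ j ∈ Icc 1 n, (1 + y j) ≤ Real.exp (∑ j ∈ Icc 1 n, y j) := by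
    rw [Real.exp_sum]
    refine prod_le_prod ?_ ?_
    · intro j hj
      have := (abs_le.1 (hy j hj)).1
      linarith
    · intro j _
      have := Real.add_one_le_exp (y j)
      linarith
  have h2 : Real.exp (∑ j ∈ Icc 1 n, (x j - 2 * e ^ 2)) ≤ ∏ j ∈ Icc 1 n, (1 + x j) := by
    rw [Real.exp_sum]
    refine prod_le_prod (fun _ _ => (Real.exp_pos _).le) ?_
    intro j hj
    have h3 := abs_le.1 (hx j hj)
    refine le_trans (Real.exp_le_exp.2 ?_) (aux_log (x j) (by linarith))
    have : x j ^ 2 ≤ e ^ 2 := sq_le_sq' h3.1 h3.2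
    linarith
  refine lt_of_le_of_lt h1 (lt_of_lt_of_le (Real.exp_lt_exp.2 ?_) h2)
  rw [sum_sub_distrib, sum_const, Nat.card_Icc, nsmul_eq_mul]
  simp only [Nat.add_sub_cancel]
  linarith

lemma aux_sum (n : ℕ) (p q : ℝ) :
    ∑ j ∈ Icc 1 n, (p * (j : ℝ) + q) = p * (n * (n + 1) / 2) + q * n := by
  induction n with
  | zero => simp
  | succ n ih => rw [sum_Icc_succ_top (by omega), ih]; push_cast; ring

lemma aux_reflect (r : ℕ → ℝ) (n : ℕ) (hr : ∀ j ∈ Icc 1 n, 0 < r j) (k : ℕ) (hk : k ≤ n) :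
    (∏ j ∈ Icc 1 n, r j) * ∏ j ∈ Icc 1 k, (r (n + 1 - j))⁻¹ = ∏ j ∈ Icc 1 (n - k), r j := by
  induction k with
  | zero => simp
  | succ k ih =>
    rw [prod_Icc_succ_top (by omega), ← mul_assoc, ih (by omega)]
    obtain ⟨m, hm⟩ : ∃ m, n - k = m + 1 := ⟨n - k - 1, by omega⟩
    have e1 : n + 1 - (k + 1) = m + 1 := by omega
    have e2 : n - (k + 1) = m := by omega
    rw [e1, e2, hm, prod_Icc_succ_top (by omega)]
    have := hr (m + 1) (by simp; omega)
    field_simp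

lemma aux_one_add (n : ℕ) (f : ℕ → ℝ) :
    1 + ∑ k ∈ Icc 1 n, ∏ j ∈ Icc 1 k, f j = ∑ k ∈ range (n + 1), ∏ j ∈ Icc 1 k, f j := by
  induction n with
  | zero => simp
  | succ n ih => rw [sum_Icc_succ_top (by omega), sum_range_succ, ← ih]; ring

lemma aux_rho (a b c d w : ℝ) (n : ℕ) (hA : ∀ j ∈ Icc 1 n, 0 < fA a b (n + 1) w j)
    (hB : ∀ j ∈ Icc 1 n, 0 < fB c d (n + 1) w j) :
    0 < rhoA a b c d (n + 1) w ∧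
    rhoB a b c d (n + 1) w * ∏ j ∈ Icc 1 n, fA a b (n + 1) w j =
      rhoA a b c d (n + 1) w * ∏ j ∈ Icc 1 n, fB c d (n + 1) w j := by
  set r : ℕ → ℝ := fun j => fB c d (n + 1) w j / fA a b (n + 1) w j with hr
  have hrp : ∀ j ∈ Icc 1 n, 0 < r j := fun j hj => div_pos (hB j hj) (hA j hj)
  have h1 : rhoA a b c d (n + 1) w = 1 / ∑ k ∈ range (n + 1), ∏ j ∈ Icc 1 k, r j := by
    rw [← aux_one_add]; rfl
  have h2 : rhoB a b c d (n + 1) w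
      = 1 / ∑ k ∈ range (n + 1), ∏ j ∈ Icc 1 k, (r (n + 1 - j))⁻¹ := by
    rw [← aux_one_add n (fun j => (r (n + 1 - j))⁻¹)]
    simp only [rhoB, hr, inv_div, Nat.add_sub_cancel]
  have h3 : (∏ j ∈ Icc 1 n, r j) * ∑ k ∈ range (n + 1), ∏ j ∈ Icc 1 k, (r (n + 1 - j))⁻¹
      = ∑ k ∈ range (n + 1), ∏ j ∈ Icc 1 k, r j := by
    rw [← sum_range_reflect, mul_sum]
    refine sum_congr rfl ?_
    intro k hk
    have hk' := mem_range.1 hk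
    rw [aux_reflect r n hrp _ (by omega)]
    congr 2; omega
  have hS : 0 < ∑ k ∈ range (n + 1), ∏ j ∈ Icc 1 k, r j := by
    refine sum_pos ?_ ⟨0, by simp⟩
    intro k hk
    have hk' := mem_range.1 hk
    refine prod_pos fun j hj => hrp j ?_
    simp only [mem_Icc] at hj ⊢; omega
  have hPA : 0 < ∏ j ∈ Icc 1 n, fA a b (n + 1) w j := prod_pos hA
  have hP : 0 < ∏ j ∈ Icc 1 n, r j := prod_pos hrp
  have hPe : (∏ j ∈ Icc 1 n, r j) * ∏ j ∈ Icc 1 n, fA a b (n + 1) w j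
      = ∏ j ∈ Icc 1 n, fB c d (n + 1) w j := by
    rw [← prod_mul_distrib]
    exact prod_congr rfl fun j hj => div_mul_cancel₀ _ (hA j hj).ne'
  refine ⟨by rw [h1]; positivity, ?_⟩
  rw [h1, h2, ← hPe]
  rw [← h3] at hS ⊢
  have hT := pos_of_mul_pos_right hS hP.le
  field_simp

lemma aux_bound (M w p q n s t : ℝ) (hw : 0 < w) (hn : 0 < n) (hM : |p| + |q| ≤ M)
    (hs : 0 ≤ s) (hs' : s ≤ n) (ht : 0 ≤ t) (ht' : t ≤ n) :
    |w * (p * s + q * t) / n| ≤ w * M := by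
  rw [abs_div, abs_mul, abs_of_pos hw, abs_of_pos hn, div_le_iff₀ hn, mul_assoc]
  refine mul_le_mul_of_nonneg_left ?_ hw.le
  calc |p * s + q * t| ≤ |p * s| + |q * t| := abs_add_le _ _
    _ = |p| * s + |q| * t := by rw [abs_mul, abs_mul, abs_of_nonneg hs, abs_of_nonneg ht]
    _ ≤ |p| * n + |q| * n := by gcongr
    _ = (|p| + |q|) * n := by ring
    _ ≤ M * n := by gcongr

/-- Everything needed from the sizes of `w` and `N`. -/
lemma aux_main (a b c d D : ℝ) (hD : 0 < D) :
    ∃ w' > (0 : ℝ), ∀ w : ℝ, 0 < w → w < w' → ∃ N₀ : ℕ, ∀ N : ℕ, N₀ ≤ N →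
      (a + b - (c + d) = D → rhoA a b c d N w > rhoB a b c d N w) ∧
      (c + d - (a + b) = D → rhoA a b c d N w < rhoB a b c d N w) := by
  obtain ⟨M, hM⟩ : ∃ M, M = |a| + |b| + |c| + |d| + 1 := ⟨_, rfl⟩
  have ha := abs_nonneg a
  have hb := abs_nonneg b
  have hc := abs_nonneg c
  have hd := abs_nonneg d
  have hM0 : 0 < M := by linarith
  refine ⟨min (1 / (4 * M)) (D / (8 * M ^ 2)), by positivity, ?_⟩
  intro w hw hw'
  have hw1 : w * M < 1 / 2 := by
    have := lt_of_lt_of_le hw' (min_le_left _ _)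
    rw [lt_div_iff₀ (by positivity)] at this
    linarith
  have hw2 : w * (8 * M ^ 2) < D := by
    have := lt_of_lt_of_le hw' (min_le_right _ _)
    rwa [lt_div_iff₀ (by positivity)] at this
  obtain ⟨K, hK⟩ := exists_nat_gt (8 * M / D)
  rw [div_lt_iff₀ hD] at hK
  refine ⟨K + 2, fun N hN => ?_⟩
  obtain ⟨n, rfl⟩ : ∃ n, N = n + 1 := ⟨N - 1, by omega⟩
  have hn : (0 : ℝ) < n := by exact_mod_cast (by omega : 0 < n)
  have hKn : (K : ℝ) ≤ n := by exact_mod_cast (by omega : K ≤ n)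
  have hnD : 8 * M < n * D := lt_of_lt_of_le hK (by gcongr)
  set x : ℕ → ℝ := fun j =>
    w * (a * ((j : ℝ) - 1) + b * (((n + 1 : ℕ) : ℝ) - (j : ℝ))) / (((n + 1 : ℕ) : ℝ) - 1) with hx
  set y : ℕ → ℝ := fun j =>
    w * (c * (j : ℝ) + d * (((n + 1 : ℕ) : ℝ) - (j : ℝ) - 1)) / (((n + 1 : ℕ) : ℝ) - 1) with hy
  have hnn : (((n + 1 : ℕ) : ℝ) - 1) = n := by push_cast; ring
  have hxb : ∀ j ∈ Icc 1 n, |x j| ≤ w * M := by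
    intro j hj
    have hj := mem_Icc.1 hj
    have h1 : (1 : ℝ) ≤ j := by exact_mod_cast hj.1
    have h2 : (j : ℝ) ≤ n := by exact_mod_cast hj.2
    simp only [hx, hnn]
    apply aux_bound <;> first | assumption | (push_cast; linarith)
  have hyb : ∀ j ∈ Icc 1 n, |y j| ≤ w * M := by
    intro j hj
    have hj := mem_Icc.1 hj
    have h1 : (1 : ℝ) ≤ j := by exact_mod_cast hj.1
    have h2 : (j : ℝ) ≤ n := by exact_mod_cast hj.2
    simp only [hy, hnn]
    apply aux_bound <;> first | assumption | (push_cast; linarith)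
  have hxs : ∑ j ∈ Icc 1 n, x j = w * (a * (n - 1) + b * (n + 1)) / 2 := by
    have : ∀ j ∈ Icc 1 n, x j = (w * (a - b) / n) * (j : ℝ) + w * (b * (n + 1) - a) / n := by
      intro j _
      simp only [hx, hnn]; push_cast; field_simp; ring
    rw [sum_congr rfl this, aux_sum]; field_simp; ring
  have hys : ∑ j ∈ Icc 1 n, y j = w * (c * (n + 1) + d * (n - 1)) / 2 := by
    have : ∀ j ∈ Icc 1 n, y j = (w * (c - d) / n) * (j : ℝ) + w * (d * n) / n := by
      intro j _
      simp only [hy, hnn]; push_cast; field_simp; ring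
    rw [sum_congr rfl this, aux_sum]; field_simp; ring
  have hA : ∀ j ∈ Icc 1 n, 0 < fA a b (n + 1) w j := by
    intro j hj
    have := (abs_le.1 (hxb j hj)).1
    change 0 < 1 + x j
    linarith
  have hB : ∀ j ∈ Icc 1 n, 0 < fB c d (n + 1) w j := by
    intro j hj
    have := (abs_le.1 (hyb j hj)).1
    change 0 < 1 + y j
    linarith
  obtain ⟨hr, he⟩ := aux_rho a b c d w n hA hB
  have hPA := prod_pos hA
  have hPB := prod_pos hB
  have hsq : n * (2 * (w * M) ^ 2) ≤ w * (n * D / 4) := by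
    have := mul_le_mul_of_nonneg_left hw2.le (by positivity : 0 ≤ n * w / 4)
    nlinarith
  have habs := And.intro (abs_le.1 (le_refl |a|)) (And.intro (abs_le.1 (le_refl |b|))
    (And.intro (abs_le.1 (le_refl |c|)) (abs_le.1 (le_refl |d|))))
  obtain ⟨⟨a1, a2⟩, ⟨b1, b2⟩, ⟨c1, c2⟩, d1, d2⟩ := habs
  constructor
  · intro hDe
    have hlt : ∏ j ∈ Icc 1 n, fB c d (n + 1) w j < ∏ j ∈ Icc 1 n, fA a b (n + 1) w j := by
      refine aux_prod n x y (w * M) hw1.le hxb hyb ?_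
      rw [hxs, hys]
      have key : 0 < (n * D + (b - a - c + d)) / 2 - n * D / 4 := by linarith
      have := mul_pos hw key
      rw [← hDe] at this hsq
      nlinarith
    have := mul_lt_mul_of_pos_left hlt hr
    rw [← he] at this
    exact lt_of_mul_lt_mul_right this hPA.le
  · intro hDe
    have hlt : ∏ j ∈ Icc 1 n, fA a b (n + 1) w j < ∏ j ∈ Icc 1 n, fB c d (n + 1) w j := by
      refine aux_prod n y x (w * M) hw1.le hyb hxb ?_
      rw [hxs, hys]
      have key : 0 < (n * D - (b - a - c + d)) / 2 - n * D / 4 := by linarith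
      have := mul_pos hw key
      rw [← hDe] at this hsq
      nlinarith
    have := mul_lt_mul_of_pos_left hlt hr
    rw [← he] at this
    exact lt_of_mul_lt_mul_right this hPA.le

/-- If a + b > c + d then ρ_A > ρ_B in the Nw limit; if a + b < c + d then
ρ_A < ρ_B in the Nw limit. -/
theorem rhoA_vs_rhoB_Nw (a b c d : ℝ) :
    (a + b > c + d →
      ∃ w' > (0 : ℝ), ∀ w : ℝ, 0 < w → w < w' → ∃ N₀ : ℕ, ∀ N : ℕ, N₀ ≤ N →
        rhoA a b c d N w > rhoB a b c d N w) ∧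
    (a + b < c + d →
      ∃ w' > (0 : ℝ), ∀ w : ℝ, 0 < w → w < w' → ∃ N₀ : ℕ, ∀ N : ℕ, N₀ ≤ N →
        rhoA a b c d N w < rhoB a b c d N w) := by
  constructor
  · intro h
    obtain ⟨w', hw', H⟩ := aux_main a b c d (a + b - (c + d)) (by linarith)
    refine ⟨w', hw', fun w h1 h2 => ?_⟩
    obtain ⟨N₀, HN⟩ := H w h1 h2
    exact ⟨N₀, fun N hN => (HN N hN).1 rfl⟩
  · intro h
    obtain ⟨w', hw', H⟩ := aux_main a b c d (c + d - (a + b)) (by linarith)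
    refine ⟨w', hw', fun w h1 h2 => ?_⟩
    obtain ⟨N₀, HN⟩ := H w h1 h2
    exact ⟨N₀, fun N hN => (HN N hN).2 rfl⟩
end
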